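/- arXiv:1410.1839 — 4 statements merged into one kernel-verified Lean document; each statement's English description precedes it below -/
import Mathlib

section
/- Consider the greedy online algorithm for the LoadBalancing problem with unit-size jobs and threshold parameter α (a positive integer): when a job j arrives it is dispatched to the machine in S_j with smallest current load, unless every machine in S_j has load at least α·T*, in which case the job is rejected. Suppose n is the first time at which the algorithm has rejected more than an ε-fraction of the jobs that have arrived, and suppose the offline optimum value of the instance is at most T*. For 0 ≤ s ≤ α let M_s be the set of machines whose load at time n is at least s·T*, and let m_s = |M_s|. Then for every s with 0 ≤ s < α, m_s ≥ 2^{α−1−s} · m_α. -/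
open Finset

/-!
Online restricted-assignment `LoadBalancing` with unit-size jobs.  Jobs are indexed
`0, 1, …, n-1` in order of arrival (one arrival per unit time, so "time `t`" means
"after the first `t` jobs have been handled").  Job `j` may only go on a machine in
`S j`.  `assign j = some i` means the greedy algorithm dispatched `j` to machine `i`;
`assign j = none` means it rejected `j`.  `load i t` is the number of (non-rejected)
jobs among the first `t` jobs dispatched to machine `i`.  The greedy algorithm sends
each arriving job to a least-loaded machine of `S j`, rejecting it iff every machine
of `S j` already has load at least `α·T*`.  `n` is the first time at which more than
an `ε`-fraction of the arrived jobs has been rejected, and the offline optimum (an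
assignment of every job, witnessed by `opt`) has maximum load at most `T*`.
With `M_s` the set of machines of load at least `s·T*` at time `n` and
`msize s = |M_s|`, we conclude `msize s ≥ 2^(α-1-s) · msize α` for all `s < α`.
-/
theorem loadbalancing_unit_level_sets
    (n m : ℕ) (Tstar α : ℕ) (ε : ℝ)
    (hα : 0 < α) (hT : 0 < Tstar) (hε : 0 < ε)
    (S : Fin n → Finset (Fin m))
    (hS : ∀ j, (S j).Nonempty)
    (assign : Fin n → Option (Fin m))
    (hassign : ∀ j i, assign j = some i → i ∈ S j)
    (load : Fin m → ℕ → ℕ)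
    (hload : ∀ i t, load i t =
      ((univ : Finset (Fin n)).filter (fun j : Fin n => (j : ℕ) < t ∧ assign j = some i)).card)
    -- greedy dispatch rule: if some allowed machine has load `< α·T*`, dispatch to a
    -- least-loaded allowed machine
    (hgreedy : ∀ j : Fin n, (∃ i ∈ S j, load i (j : ℕ) < α * Tstar) →
      ∃ i ∈ S j, assign j = some i ∧ ∀ i' ∈ S j, load i (j : ℕ) ≤ load i' (j : ℕ))
    -- rejection rule: a job is rejected only when all its allowed machines are full
    (hreject : ∀ j : Fin n, assign j = none → ∀ i ∈ S j, α * Tstar ≤ load i (j : ℕ))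
    (rejected : ℕ → ℕ)
    (hrejected : ∀ t, rejected t =
      ((univ : Finset (Fin n)).filter (fun j : Fin n => (j : ℕ) < t ∧ assign j = none)).card)
    -- `n` is the first time at which more than an `ε`-fraction of jobs is rejected
    (hfirst : ε * n < (rejected n : ℝ))
    (hbefore : ∀ t < n, (rejected t : ℝ) ≤ ε * t)
    -- the offline optimum value is at most `T*`
    (opt : Fin n → Fin m)
    (hopt : ∀ j, opt j ∈ S j)
    (hoptload : ∀ i : Fin m,
      ((univ : Finset (Fin n)).filter (fun j => opt j = i)).card ≤ Tstar)
    (msize : ℕ → ℕ)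
    (hmsize : ∀ s, msize s =
      ((univ : Finset (Fin m)).filter (fun i => s * Tstar ≤ load i n)).card) :
    ∀ s < α, 2 ^ (α - 1 - s) * msize α ≤ msize s := by
  -- every level below the final load is realised by some job
  have hlev : ∀ i : Fin m, ∀ l t : ℕ, l < load i t →
      ∃ j : Fin n, assign j = some i ∧ load i (j : ℕ) = l := by
    intro i l t
    induction t with
    | zero => intro h; simp [hload] at h
    | succ t ih =>
      intro h
      by_cases h1 : l < load i t
      · exact ih h1
      · have hle : load i t ≤ l := not_lt.mp h1
        by_cases hj : ∃ j : Fin n, (j : ℕ) = t ∧ assign j = some i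
        · obtain ⟨j, hjt, hja⟩ := hj
          refine ⟨j, hja, ?_⟩
          have : load i (t + 1) ≤ load i t + 1 := by
            rw [hload, hload]
            refine le_trans (Finset.card_le_card (t := insert j
              (univ.filter (fun j : Fin n => (j : ℕ) < t ∧ assign j = some i))) ?_)
              (Finset.card_insert_le _ _)
            intro k hk
            simp only [mem_filter, mem_univ, true_and, mem_insert] at hk ⊢
            by_cases hkt : (k : ℕ) = t
            · left; exact Fin.ext (by omega)
            · right; exact ⟨by omega, hk.2⟩
          rw [hjt]; omega
        · exfalso
          have : load i (t + 1) ≤ load i t := by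
            rw [hload, hload]
            refine Finset.card_le_card ?_
            intro k hk
            simp only [mem_filter, mem_univ, true_and] at hk ⊢
            have : (k : ℕ) ≠ t := fun h => hj ⟨k, h, hk.2⟩
            exact ⟨by omega, hk.2⟩
          omega
  have hmono : ∀ i : Fin m, ∀ t ≤ n, load i t ≤ load i n := by
    intro i t ht
    rw [hload, hload]
    refine Finset.card_le_card ?_
    intro k hk
    simp only [mem_filter, mem_univ, true_and] at hk ⊢
    exact ⟨k.2, hk.2⟩
  have key : ∀ s < α, ∑ r ∈ Finset.Ico s α, msize (r + 1) ≤ msize s := by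
    intro s hs
    let P : Finset (Σ _ : ℕ, ℕ × Fin m) := (Finset.Ico s α).sigma (fun r =>
      (Finset.range Tstar) ×ˢ (univ.filter (fun i : Fin m => (r + 1) * Tstar ≤ load i n)))
    let J : Finset (Fin n) := univ.filter (fun j => s * Tstar ≤ load (opt j) n)
    have hP : P.card = Tstar * ∑ r ∈ Finset.Ico s α, msize (r + 1) := by
      simp only [P, Finset.card_sigma, Finset.card_product, Finset.card_range, hmsize,
        Finset.mul_sum]
    have hJ : J.card ≤ Tstar * msize s := by
      rw [hmsize]
      refine Finset.card_le_mul_card_image_of_maps_to (f := opt) ?_ Tstar ?_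
      · intro j hj
        simpa [J] using hj
      · intro i _
        refine le_trans (Finset.card_le_card ?_) (hoptload i)
        intro j hj
        simp only [mem_filter, mem_univ, true_and] at hj ⊢
        exact hj.2
    have hex : ∀ p : (Σ _ : ℕ, ℕ × Fin m), p ∈ P → ∃ j : Fin n,
        assign j = some p.2.2 ∧ load p.2.2 (j : ℕ) = p.1 * Tstar + p.2.1 := by
      rintro ⟨r, q, i⟩ hp
      simp only [P, mem_sigma, mem_product, mem_filter, mem_univ, true_and, mem_range,
        mem_Ico] at hp
      exact hlev i _ n (by have := hp.2.2; rw [add_mul] at this; simp only; omega)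
    have hPJ : P.card ≤ J.card := by
      refine Finset.card_le_card_of_forall_subsingleton (fun p j =>
        assign j = some p.2.2 ∧ load p.2.2 (j : ℕ) = p.1 * Tstar + p.2.1) ?_ ?_
      · intro p hp
        obtain ⟨j, hj1, hj2⟩ := hex p hp
        refine ⟨j, ?_, hj1, hj2⟩
        obtain ⟨r, q, i⟩ := p
        simp only [P, mem_sigma, mem_product, mem_filter, mem_univ, true_and, mem_range,
          mem_Ico] at hp hj1 hj2
        obtain ⟨⟨hr1, hr2⟩, hq, hi⟩ := hp
        have hlt : load i (j : ℕ) < α * Tstar := by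
          have : (r + 1) * Tstar ≤ α * Tstar := Nat.mul_le_mul_right _ hr2
          rw [add_mul] at this; omega
        obtain ⟨i', _, ha, hmin⟩ := hgreedy j ⟨i, hassign j i hj1, hlt⟩
        have hii : i' = i := by rw [hj1] at ha; exact (Option.some.inj ha).symm
        subst hii
        have h1 := hmin (opt j) (hopt j)
        have h2 := hmono (opt j) j j.2.le
        have h3 : s * Tstar ≤ r * Tstar := Nat.mul_le_mul_right _ hr1
        simp only [J, mem_filter, mem_univ, true_and]
        omega
      · rintro j _ ⟨r, q, i⟩ ⟨hp, h1, h2⟩ ⟨r', q', i'⟩ ⟨hp', h1', h2'⟩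
        simp only [P, mem_sigma, mem_product, mem_filter, mem_univ, true_and, mem_range,
          mem_Ico] at hp hp' h1 h2 h1' h2'
        have hii : i = i' := by rw [h1] at h1'; exact Option.some.inj h1'
        subst hii
        have he : r * Tstar + q = r' * Tstar + q' := by omega
        have hq : q = q' := by
          have := congrArg (· % Tstar) he
          simpa [Nat.mul_add_mod', Nat.mod_eq_of_lt hp.2.1, Nat.mod_eq_of_lt hp'.2.1] using this
        subst hq
        have hr : r = r' := Nat.eq_of_mul_eq_mul_right hT (by omega)
        subst hr
        rfl
    exact Nat.le_of_mul_le_mul_left (by omega : Tstar * _ ≤ Tstar * _) hT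
  have hsum : ∀ k < α, 2 ^ k * msize α ≤ ∑ r ∈ Finset.Ico (α - 1 - k) α, msize (r + 1) := by
    intro k
    induction k with
    | zero =>
      intro _
      obtain ⟨a, rfl⟩ : ∃ a, α = a + 1 := ⟨α - 1, by omega⟩
      simp
    | succ k ih =>
      intro hk
      have h1 := ih (by omega)
      have h2 := key (α - 1 - k) (by omega)
      rw [Finset.sum_eq_sum_Ico_succ_bot (by omega : α - 1 - (k + 1) < α)]
      have e : α - 1 - (k + 1) + 1 = α - 1 - k := by omega
      rw [e, pow_succ]
      linarith
  intro s hs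
  have h1 := hsum (α - 1 - s) (by omega)
  have e : α - 1 - (α - 1 - s) = s := by omega
  rw [e] at h1
  exact h1.trans (key s hs)
end

section
/- Assume the value T* of the offline optimum is known and that the jobs of a restricted-assignment LoadBalancing instance are Δ-separated with Δ = log(1/ε) + 2. Then the two-stage algorithm — Stage 1: when a job of class l arrives, dispatch it to the machine i ∈ S_j minimizing the total size of class-l jobs currently queued at i, rejecting the job if this quantity is at least α·T* on all machines of S_j; Stage 2: whenever the total load on a machine exceeds 2α·T*, repeatedly remove the largest jobs in its queue until the load is at most 2α·T* — is O(log(1/ε))-competitive and rejects at most an ε-fraction of the jobs. -/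
open Finset
open scoped Classical

namespace LBaux

/-- few good jobs of higher classes -/
lemma high_count {n : ℕ} (H : Finset (Fin n)) (p : Fin n → ℝ) (c : Fin n → ℤ)
    (V ε : ℝ) (Δ : ℕ) (l : ℤ) (hV : 0 < V) (hε : 0 < ε) (hε2 : ε ≤ 1 / 2)
    (hΔ : (2 : ℝ) ^ Δ = 4 / ε)
    (hc : ∀ j, (2 : ℝ) ^ (c j) ≤ p j)
    (hk : ∀ j ∈ H, ∃ k : ℕ, c j = l + (k + 1 : ℕ) * (Δ : ℤ))
    (hG : ∀ k, ∑ j ∈ H.filter (fun j => c j = k), p j ≤ V) :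
    (H.card : ℝ) * 2 ^ l ≤ 2 / 7 * ε * V := by
  choose! f hf using hk
  obtain ⟨N, hN⟩ : ∃ N : ℕ, ∀ j ∈ H, f j < N :=
    ⟨H.sup f + 1, fun j hj => Nat.lt_succ_of_le (Finset.le_sup hj)⟩
  have hl : (0 : ℝ) < 2 ^ l := by positivity
  have h1 : H.card = ∑ k ∈ range N, (H.filter (fun j => f j = k)).card :=
    Finset.card_eq_sum_card_fiberwise (fun j hj => by simpa using hN j hj)
  have hq : ∀ k : ℕ, ((H.filter (fun j => f j = k)).card : ℝ) * 2 ^ l ≤ V * (ε / 4) * (ε / 4) ^ k := by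
    intro k
    have e1 : ((H.filter (fun j => f j = k)).card : ℝ) * (2 : ℝ) ^ (l + (k + 1 : ℕ) * (Δ : ℤ)) ≤ V := by
      refine le_trans ?_ (hG (l + (k + 1 : ℕ) * (Δ : ℤ)))
      have : H.filter (fun j => f j = k) ⊆ H.filter (fun j => c j = l + (k + 1 : ℕ) * (Δ : ℤ)) := by
        intro j hj
        simp only [mem_filter] at hj ⊢
        refine ⟨hj.1, ?_⟩
        rw [hf j hj.1, hj.2]
      refine le_trans ?_ (Finset.sum_le_sum_of_subset_of_nonneg this ?_)
      · rw [← nsmul_eq_mul]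
        apply Finset.card_nsmul_le_sum
        intro j hj
        have := this hj
        simp only [mem_filter] at this
        rw [← this.2]; exact hc j
      · intro j _ _
        exact le_trans (by positivity) (hc j)
    have e2 : (2 : ℝ) ^ (l + (k + 1 : ℕ) * (Δ : ℤ)) = 2 ^ l * (4 / ε) ^ (k + 1) := by
      rw [zpow_add₀ (by norm_num), ← hΔ, ← pow_mul, mul_comm Δ]
      norm_cast
    rw [e2] at e1
    have e3 : (ε / 4) ^ (k + 1) * (4 / ε) ^ (k + 1) = 1 := by
      rw [← mul_pow]
      have : ε / 4 * (4 / ε) = 1 := by field_simp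
      rw [this, one_pow]
    have e4 : (0 : ℝ) < (ε / 4) ^ (k + 1) := by positivity
    calc ((H.filter (fun j => f j = k)).card : ℝ) * 2 ^ l
        = (((H.filter (fun j => f j = k)).card : ℝ) * (2 ^ l * (4 / ε) ^ (k + 1))) * (ε / 4) ^ (k + 1) := by
          linear_combination (-((H.filter (fun j => f j = k)).card : ℝ) * 2 ^ l) * e3
      _ ≤ V * (ε / 4) ^ (k + 1) := by gcongr
      _ = _ := by ring
  have hgeo : ∑ k ∈ range N, (ε / 4) ^ k ≤ 8 / 7 := by
    have := geom_sum_mul (ε / 4) N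
    have h0 : 0 ≤ (ε / 4) ^ N := by positivity
    have h2 : (0:ℝ) ≤ ∑ k ∈ range N, (ε / 4) ^ k := Finset.sum_nonneg (fun _ _ => by positivity)
    nlinarith
  rw [h1]; push_cast
  rw [Finset.sum_mul]
  calc _ ≤ ∑ k ∈ range N, V * (ε / 4) * (ε / 4) ^ k := Finset.sum_le_sum (fun k _ => hq k)
    _ = V * (ε / 4) * ∑ k ∈ range N, (ε / 4) ^ k := by rw [Finset.mul_sum]
    _ ≤ V * (ε / 4) * (8 / 7) := by gcongr
    _ = _ := by ring

lemma machine {n : ℕ} (D R : Finset (Fin n)) (bad : Fin n → Prop) (p : Fin n → ℝ) (c : Fin n → ℤ)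
    (T α ε : ℝ) (Δ : ℕ) (hα : 4 ≤ α) (hT : 0 < T) (hε : 0 < ε) (hε2 : ε ≤ 1 / 2)
    (hΔ : (2 : ℝ) ^ Δ = 4 / ε) (hΔ0 : 0 < Δ)
    (hc : ∀ j, (2 : ℝ) ^ (c j) ≤ p j ∧ p j < 2 ^ (c j + 1))
    (hsep : ∃ k₀ : ℤ, ∀ j, ∃ i : ℤ, c j = k₀ + i * (Δ : ℤ))
    (hG : ∀ k, ∑ j ∈ D.filter (fun j => ¬ bad j ∧ c j = k), p j ≤ (α + 1) * T)
    (hRD : R ⊆ D)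
    (hR : ∀ j ∈ R, 2 * α * T ≤
      ∑ j' ∈ D.filter (fun j' => p j' < p j ∨ (p j' = p j ∧ j' < j)), p j') :
    (R.card : ℝ) ≤ (D.filter bad).card + ε / 2 * D.card := by
  have hp : ∀ j, 0 < p j := fun j => lt_of_lt_of_le (by positivity) (hc j).1
  rcases R.eq_empty_or_nonempty with rfl | hne
  · simp; positivity
  obtain ⟨j0, hj0, hmin⟩ := Finset.exists_min_image R (fun j => toLex (p j, j)) hne
  have hsum := hR j0 hj0
  set K := D.filter (fun j' => p j' < p j0 ∨ (p j' = p j0 ∧ j' < j0)) with hK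
  have hKp : ∀ j ∈ K, p j ≤ p j0 := by
    intro j hj
    simp only [hK, mem_filter] at hj
    rcases hj.2 with h | h
    · exact h.le
    · exact h.1.le
  have hKn : ∀ j ∈ D, j ∉ K → p j0 ≤ p j := by
    intro j hj hjK
    simp only [hK, mem_filter, not_and, not_or] at hjK
    exact not_lt.1 (hjK hj).1
  have hcmono : ∀ j j', p j ≤ p j' → c j ≤ c j' := by
    intro j j' h
    have : (2:ℝ) ^ (c j) < 2 ^ (c j' + 1) := lt_of_le_of_lt ((hc j).1.trans h) (hc j').2
    rw [zpow_lt_zpow_iff_right₀ (by norm_num)] at this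
    omega
  have hRK : R ⊆ D \ K := by
    intro j hj
    rw [mem_sdiff]
    refine ⟨hRD hj, fun h => ?_⟩
    simp only [hK, mem_filter] at h
    have := hmin j hj
    rw [Prod.Lex.toLex_le_toLex] at this
    simp only at this
    rcases this with h1 | ⟨h1, h2⟩
    · rcases h.2 with h3 | h3
      · exact lt_asymm h1 h3
      · exact h1.ne' h3.1
    · rcases h.2 with h3 | h3
      · exact h3.ne' h1
      · exact absurd h3.2 (not_lt.2 h2)
  set l := c j0 with hl
  have hs : (0:ℝ) < 2 ^ l := by positivity
  -- parts
  set g := D.filter (fun j => ¬ bad j ∧ c j = l) with hg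
  set bl := D.filter (fun j => bad j ∧ c j = l) with hbl
  set gh := D.filter (fun j => ¬ bad j ∧ l < c j) with hgh
  set bh := D.filter (fun j => bad j ∧ l < c j) with hbh
  set Kl := K.filter (fun j => c j = l) with hKl
  set Y := K.filter (fun j => ¬ c j = l) with hY
  have hKsub : K ⊆ D := Finset.filter_subset _ _
  have cardR : R.card + Kl.card ≤ g.card + bl.card + gh.card + bh.card := by
    have hd : Disjoint R Kl := by
      rw [Finset.disjoint_left]
      intro j hj hj'
      exact (mem_sdiff.1 (hRK hj)).2 (mem_filter.1 hj').1
    rw [← Finset.card_union_of_disjoint hd]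
    have : R ∪ Kl ⊆ ((g ∪ bl) ∪ gh) ∪ bh := by
      intro j hj
      have h1 : j ∈ D ∧ l ≤ c j := by
        rcases mem_union.1 hj with h | h
        · have := mem_sdiff.1 (hRK h)
          exact ⟨this.1, hcmono _ _ (hKn j this.1 this.2)⟩
        · have := mem_filter.1 h
          exact ⟨hKsub this.1, this.2.ge⟩
      simp only [hg, hbl, hgh, hbh, mem_union, mem_filter]
      have := h1.2.lt_or_eq
      by_cases hb : bad j <;> rcases this with h2 | h2 <;> simp [h1.1, hb, h2]
    refine (Finset.card_le_card this).trans ?_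
    have a1 := Finset.card_union_le ((g ∪ bl) ∪ gh) bh
    have a2 := Finset.card_union_le (g ∪ bl) gh
    have a3 := Finset.card_union_le g bl
    omega
  have cardbad : bl.card + bh.card ≤ (D.filter bad).card := by
    have hd : Disjoint bl bh := by
      rw [Finset.disjoint_left]
      intro j hj hj'
      have h1 := (mem_filter.1 hj).2.2
      have h2 := (mem_filter.1 hj').2.2
      omega
    rw [← Finset.card_union_of_disjoint hd]
    apply Finset.card_le_card
    intro j hj
    rcases mem_union.1 hj with h | h <;> have := mem_filter.1 h <;> exact mem_filter.2 ⟨this.1, this.2.1⟩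
  have hgh_bound : (gh.card : ℝ) * 2 ^ l ≤ 2 / 7 * ε * ((α + 1) * T) := by
    refine high_count gh p c _ ε Δ l (by positivity) hε hε2 hΔ (fun j => (hc j).1) ?_ ?_
    · intro j hj
      have hlt := (mem_filter.1 hj).2.2
      obtain ⟨k0, h0⟩ := hsep
      obtain ⟨a, ha⟩ := h0 j
      obtain ⟨b, hb⟩ := h0 j0
      have : b < a := by
        by_contra hcon
        push Not at hcon
        have : a * (Δ:ℤ) ≤ b * Δ := mul_le_mul_of_nonneg_right hcon (by positivity)
        omega
      refine ⟨(a - b - 1).toNat, ?_⟩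
      have e : (((a - b - 1).toNat + 1 : ℕ) : ℤ) = a - b := by omega
      rw [e, ha, hl, hb]; ring
    · intro k
      refine le_trans (Finset.sum_le_sum_of_subset_of_nonneg ?_ (fun j _ _ => (hp j).le)) (hG k)
      intro j hj
      simp only [hgh, mem_filter] at hj ⊢
      tauto
  have hKsplit : ∑ j ∈ Kl, p j + ∑ j ∈ Y, p j = ∑ j ∈ K, p j :=
    Finset.sum_filter_add_sum_filter_not K _ _
  have hYb : ∑ j ∈ Y, p j ≤ Y.card * (2 ^ l * (ε / 2)) := by
    rw [← nsmul_eq_mul]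
    apply Finset.sum_le_card_nsmul
    intro j hj
    have h1 := mem_filter.1 hj
    have h2 := hcmono _ _ (hKp j h1.1)
    obtain ⟨k0, h0⟩ := hsep
    obtain ⟨a, ha⟩ := h0 j
    obtain ⟨b, hb⟩ := h0 j0
    have hlt : c j < l := lt_of_le_of_ne h2 h1.2
    have : a < b := by
      by_contra hcon
      push Not at hcon
      have : b * (Δ:ℤ) ≤ a * Δ := mul_le_mul_of_nonneg_right hcon (by positivity)
      omega
    have h3 : c j + Δ ≤ l := by
      have : (a + 1) * (Δ:ℤ) ≤ b * Δ := mul_le_mul_of_nonneg_right (by omega) (by positivity)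
      rw [hl, hb, ha]; linarith
    have h4 : (2:ℝ) ^ (c j + Δ) ≤ 2 ^ l := zpow_le_zpow_right₀ (by norm_num) h3
    rw [zpow_add₀ (by norm_num), zpow_natCast, hΔ] at h4
    have h5 := (hc j).2
    rw [zpow_add₀ (by norm_num), zpow_one] at h5
    have h6 : (2:ℝ) ^ (c j) * 4 ≤ 2 ^ l * ε := by
      rw [mul_div_assoc', div_le_iff₀ hε] at h4
      exact h4
    linarith
  have hKb : ∑ j ∈ K, p j ≤ K.card * (2 ^ l * 2) := by
    rw [← nsmul_eq_mul]
    apply Finset.sum_le_card_nsmul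
    intro j hj
    have h5 := (hc j0).2
    rw [zpow_add₀ (by norm_num), zpow_one] at h5
    exact (hKp j hj).trans h5.le
  have hexch : p j0 * ((g.card : ℝ) - Kl.card) ≤ ∑ j ∈ g, p j - ∑ j ∈ Kl, p j := by
    have b1 : (0:ℝ) ≤ ∑ j ∈ g \ Kl, (p j - p j0) := by
      apply Finset.sum_nonneg
      intro j hj
      have h1 := mem_sdiff.1 hj
      have h2 := mem_filter.1 h1.1
      have : j ∉ K := fun h => h1.2 (mem_filter.2 ⟨h, h2.2.2⟩)
      linarith [hKn j h2.1 this]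
    have b2 : ∑ j ∈ Kl \ g, (p j - p j0) ≤ 0 := by
      apply Finset.sum_nonpos
      intro j hj
      linarith [hKp j (mem_filter.1 (mem_sdiff.1 hj).1).1]
    have b3 := Finset.sum_sdiff_sub_sum_sdiff (s₁ := Kl) (s₂ := g) (f := fun j => p j - p j0)
    simp only [Finset.sum_sub_distrib, Finset.sum_const, nsmul_eq_mul] at b1 b2 b3
    nlinarith
  have hgG := hG l
  have hYD : (Y.card : ℝ) ≤ D.card := by
    exact_mod_cast Finset.card_le_card ((Finset.filter_subset _ _).trans hKsub)
  have hKD : (K.card : ℝ) ≤ D.card := by exact_mod_cast Finset.card_le_card hKsub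
  have cardR' : (R.card : ℝ) + Kl.card ≤ g.card + bl.card + gh.card + bh.card := by exact_mod_cast cardR
  have cardbad' : (bl.card : ℝ) + bh.card ≤ (D.filter bad).card := by exact_mod_cast cardbad
  have key : ((g.card : ℝ) - Kl.card) + gh.card ≤ ε / 2 * D.card := by
    rw [← mul_le_mul_iff_left₀ hs]
    have hαT : 4 * T ≤ α * T := by gcongr
    rcases le_total ((g.card : ℝ) - Kl.card) 0 with he | he
    · have c1 : ((g.card : ℝ) - Kl.card) * 2 ^ l ≤ 0 := mul_nonpos_of_nonpos_of_nonneg he hs.le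
      have c2 : 2 * α * T ≤ D.card * (2 ^ l * 2) := by
        refine (hsum.trans hKb).trans ?_
        gcongr
      have c3 : ε / 4 * (2 * α * T) ≤ ε / 4 * (D.card * (2 ^ l * 2)) := by gcongr
      have c4 : ε * (4 * T) ≤ ε * (α * T) := by gcongr
      have c5 : 0 < ε * T := by positivity
      nlinarith
    · have c1 : 2 ^ l * ((g.card : ℝ) - Kl.card) ≤ p j0 * ((g.card : ℝ) - Kl.card) := by
        gcongr
        exact (hc j0).1
      have c2 : (Y.card : ℝ) * (2 ^ l * (ε / 2)) ≤ D.card * (2 ^ l * (ε / 2)) := by gcongr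
      have c3 : 2 / 7 * ε * ((α + 1) * T) ≤ 2 / 7 * (1 / 2) * ((α + 1) * T) := by
        gcongr
      nlinarith
  linarith

lemma pre_lt {n : ℕ} (A J : Finset (Fin n)) (p : Fin n → ℝ) (hp : ∀ j, 0 < p j) (x P : ℝ)
    (hx : 0 ≤ x) (hP : 0 < P) (hAJ : A ⊆ J)
    (hA : ∀ j ∈ A, ∑ j' ∈ J.filter (fun j' => j' < j), p j' < x)
    (hpP : ∀ j ∈ A, p j ≤ P) : ∑ j ∈ A, p j < x + P := by
  rcases A.eq_empty_or_nonempty with rfl | hne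
  · simp; linarith
  have hm := A.max'_mem hne
  rw [← Finset.sum_erase_add _ _ hm]
  have h1 := hA _ hm
  have h2 := hpP _ hm
  have h3 : ∑ j ∈ A.erase (A.max' hne), p j ≤ ∑ j' ∈ J.filter (fun j' => j' < A.max' hne), p j' := by
    apply Finset.sum_le_sum_of_subset_of_nonneg _ (fun j _ _ => (hp j).le)
    intro j hj
    have h4 := Finset.mem_erase.1 hj
    exact mem_filter.2 ⟨hAJ h4.2, lt_of_le_of_ne (A.le_max' j h4.2) h4.1⟩
  linarith

lemma pre_ge {n : ℕ} (J : Finset (Fin n)) (p : Fin n → ℝ) (hp : ∀ j, 0 < p j) (h : ℝ)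
    (hJ : h ≤ ∑ j ∈ J, p j) :
    h ≤ ∑ j ∈ J.filter (fun j => ∑ j' ∈ J.filter (fun j' => j' < j), p j' < h), p j := by
  rcases (J.filter (fun j => ¬ ∑ j' ∈ J.filter (fun j' => j' < j), p j' < h)).eq_empty_or_nonempty
    with he | hne
  · rw [Finset.filter_true_of_mem]
    · exact hJ
    · intro j hj
      by_contra hcon
      have : j ∈ (∅ : Finset (Fin n)) := he ▸ mem_filter.2 ⟨hj, hcon⟩
      simp at this
  · obtain ⟨j, hj, hmin⟩ := Finset.exists_min_image _ (fun j => j) hne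
    have h1 := not_lt.1 (mem_filter.1 hj).2
    refine h1.trans (Finset.sum_le_sum_of_subset_of_nonneg ?_ (fun j _ _ => (hp j).le))
    intro j' hj'
    have h2 := mem_filter.1 hj'
    refine mem_filter.2 ⟨h2.1, ?_⟩
    by_contra hcon
    exact absurd (hmin j' (mem_filter.2 ⟨h2.1, hcon⟩)) (not_le.2 h2.2)

/-- number of jobs starting at height in `[h-2T,h)` on a full machine -/
lemma tiles {n : ℕ} (J O : Finset (Fin n)) (p : Fin n → ℝ) (hp : ∀ j, 0 < p j) (h T s : ℝ)
    (hs : 0 < s) (hh : 2 * T ≤ h)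
    (hJs : ∀ j ∈ J, p j ≤ 2 * s) (hO : ∀ j ∈ O, s ≤ p j) (hOT : ∑ j ∈ O, p j ≤ T)
    (hJ : h ≤ ∑ j ∈ J, p j) :
    O.card ≤ (J.filter (fun j => h - 2 * T ≤ ∑ j' ∈ J.filter (fun j' => j' < j), p j' ∧
      ∑ j' ∈ J.filter (fun j' => j' < j), p j' < h)).card := by
  have hT0 : 0 ≤ T := le_trans (Finset.sum_nonneg (fun j _ => (hp j).le)) hOT
  set ℓ : Fin n → ℝ := fun j => ∑ j' ∈ J.filter (fun j' => j' < j), p j' with hℓ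
  have hB := pre_ge J p hp h hJ
  have hA := pre_lt (J.filter (fun j => ℓ j < h - 2 * T)) J p hp (h - 2 * T) (2 * s) (by linarith)
    (by linarith) (Finset.filter_subset _ _) (fun j hj => (mem_filter.1 hj).2)
    (fun j hj => hJs j (mem_filter.1 hj).1)
  set Q := J.filter (fun j => h - 2 * T ≤ ℓ j ∧ ℓ j < h) with hQ
  have hBQ : ∑ j ∈ J.filter (fun j => ℓ j < h), p j ≤
      ∑ j ∈ J.filter (fun j => ℓ j < h - 2 * T), p j + ∑ j ∈ Q, p j := by
    rw [← Finset.sum_union]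
    · apply Finset.sum_le_sum_of_subset_of_nonneg _ (fun j _ _ => (hp j).le)
      intro j hj
      have := mem_filter.1 hj
      rcases lt_or_ge (ℓ j) (h - 2 * T) with h1 | h1
      · exact mem_union_left _ (mem_filter.2 ⟨this.1, h1⟩)
      · exact mem_union_right _ (mem_filter.2 ⟨this.1, h1, this.2⟩)
    · rw [Finset.disjoint_left]
      intro j hj hj'
      exact absurd (mem_filter.1 hj').2.1 (not_le.2 (mem_filter.1 hj).2)
  have hQc : ∑ j ∈ Q, p j ≤ Q.card * (2 * s) := by
    rw [← nsmul_eq_mul]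
    exact Finset.sum_le_card_nsmul _ _ _ (fun j hj => hJs j (mem_filter.1 hj).1)
  have hOc : O.card * s ≤ ∑ j ∈ O, p j := by
    rw [← nsmul_eq_mul]
    exact Finset.card_nsmul_le_sum _ _ _ hO
  have : (O.card : ℝ) * s < (Q.card + 1) * s := by
    change h ≤ ∑ j ∈ J.filter (fun j => ℓ j < h), p j at hB
    linarith
  have h2 := lt_of_mul_lt_mul_right this hs.le
  have h3 : O.card < Q.card + 1 := by exact_mod_cast h2
  omega

lemma card_opt {n m : ℕ} (W : Finset (Fin n)) (f : Fin n → Option (Fin m)) :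
    W.card = (W.filter (fun j => f j = none)).card + ∑ i, (W.filter (fun j => f j = some i)).card := by
  rw [Finset.card_eq_sum_card_fiberwise (t := univ) (f := f) (fun _ _ => by simp), Fintype.sum_option]

/-- halving step -/
lemma halve {n m : ℕ} (T α : ℝ) (p : Fin n → ℝ) (c : Fin n → ℤ) (S : Fin n → Finset (Fin m))
    (assign : Fin n → Option (Fin m)) (loadC : Fin m → ℤ → ℕ → ℝ)
    (hp : ∀ j, 0 < p j)
    (hc : ∀ j, (2 : ℝ) ^ (c j) ≤ p j ∧ p j < 2 ^ (c j + 1))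
    (hS : ∀ j i, assign j = some i → i ∈ S j)
    (hL : ∀ i k t, loadC i k t =
        ∑ j ∈ (univ : Finset (Fin n)).filter
            (fun j : Fin n => (j : ℕ) < t ∧ assign j = some i ∧ c j = k), p j)
    (hgreedy : ∀ j : Fin n, (∃ i ∈ S j, loadC i (c j) (j : ℕ) < α * T) →
        ∃ i ∈ S j, assign j = some i ∧
          ∀ i' ∈ S j, loadC i (c j) (j : ℕ) ≤ loadC i' (c j) (j : ℕ))
    (opt : Fin n → Fin m) (hopt : ∀ j, opt j ∈ S j)
    (hoptT : ∀ i : Fin m,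
          (∑ j ∈ (univ : Finset (Fin n)).filter (fun j => opt j = i), p j) ≤ T)
    (t : ℕ) (l : ℤ) (h : ℝ) (h2 : 2 * T ≤ h) (hα : h ≤ α * T) (N : ℝ → Finset (Fin n))
    (hN : ∀ x, N x = univ.filter (fun j : Fin n => (j : ℕ) < t ∧ c j = l ∧
      ∀ i ∈ S j, x ≤ loadC i l j)) :
    2 * (N h).card ≤ (N (h - 2 * T)).card := by
  by_cases hn : ∃ j : Fin n, True
  swap
  · have : N h = ∅ := by
      ext j; exact absurd ⟨j, trivial⟩ hn
    simp [this]
  have hT : 0 ≤ T := by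
    obtain ⟨j, -⟩ := hn
    exact (Finset.sum_nonneg (fun j _ => (hp j).le)).trans (hoptT (opt j))
  have hsub : N h ⊆ N (h - 2 * T) := by
    intro j hj
    rw [hN] at hj ⊢
    simp only [mem_filter, mem_univ, true_and] at hj ⊢
    exact ⟨hj.1, hj.2.1, fun i hi => by linarith [hj.2.2 i hi]⟩
  set W := N (h - 2 * T) \ N h with hW
  have hWc : W.card + (N h).card = (N (h - 2 * T)).card := Finset.card_sdiff_add_card_eq_card hsub
  have main : (N h).card ≤ W.card := by
    rw [card_opt W assign,
      Finset.card_eq_sum_card_fiberwise (s := N h) (t := univ) (f := opt) (fun _ _ => by simp)]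
    refine le_trans (Finset.sum_le_sum ?_) (Nat.le_add_left _ _)
    intro i _
    rcases ((N h).filter (fun j => opt j = i)).eq_empty_or_nonempty with he | ⟨j1, hj1⟩
    · simp [he]
    set J := (univ : Finset (Fin n)).filter
            (fun j : Fin n => (j : ℕ) < t ∧ assign j = some i ∧ c j = l) with hJ
    have hpre : ∀ j : Fin n, (j : ℕ) < t →
        ∑ j' ∈ J.filter (fun j' => j' < j), p j' = loadC i l j := by
      intro j hj
      rw [hL]
      congr 1
      ext j'
      simp only [hJ, mem_filter, mem_univ, true_and, Fin.lt_def]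
      constructor
      · tauto
      · intro hh; exact ⟨⟨by omega, hh.2⟩, hh.1⟩
    have hJtot : h ≤ ∑ j ∈ J, p j := by
      simp only [hN, mem_filter, mem_univ, true_and] at hj1
      have a1 := hj1.1.2.2 i (hj1.2 ▸ hopt j1)
      rw [← hpre j1 hj1.1.1] at a1
      exact a1.trans (Finset.sum_le_sum_of_subset_of_nonneg (Finset.filter_subset _ _)
        (fun j _ _ => (hp j).le))
    have htl := tiles J ((N h).filter (fun j => opt j = i)) p hp h T (2 ^ l) (by positivity) h2
      ?_ ?_ ?_ hJtot
    · refine htl.trans (Finset.card_le_card ?_)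
      intro j hj
      have hj' := mem_filter.1 hj
      have hjJ := hj'.1
      simp only [hJ, mem_filter, mem_univ, true_and] at hjJ
      rw [hpre j hjJ.1] at hj'
      have hiS := hS j i hjJ.2.1
      obtain ⟨i2, -, hi2, hmin⟩ := hgreedy j ⟨i, hiS, by rw [hjJ.2.2]; linarith [hj'.2.2]⟩
      have : i2 = i := by rw [hjJ.2.1] at hi2; exact (Option.some.inj hi2).symm
      subst this
      rw [hjJ.2.2] at hmin
      rw [mem_filter, hW, mem_sdiff, hN, hN]
      simp only [mem_filter, mem_univ, true_and]
      refine ⟨⟨⟨hjJ.1, hjJ.2.2, fun i' hi' => hj'.2.1.trans (hmin i' hi')⟩, ?_⟩, hjJ.2.1⟩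
      intro hcon
      exact absurd (hcon.2.2 _ hiS) (not_le.2 hj'.2.2)
    · intro j hj
      simp only [hJ, mem_filter, mem_univ, true_and] at hj
      have := (hc j).2
      rw [hj.2.2, zpow_add₀ (by norm_num), zpow_one] at this
      linarith
    · intro j hj
      simp only [hN, mem_filter, mem_univ, true_and] at hj
      rw [← hj.1.2.1]; exact (hc j).1
    · refine le_trans (Finset.sum_le_sum_of_subset_of_nonneg ?_ (fun j _ _ => (hp j).le)) (hoptT i)
      intro j hj
      exact mem_filter.2 ⟨mem_univ _, (mem_filter.1 hj).2⟩
  omega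

end LBaux

/-!
Online restricted-assignment `LoadBalancing` with general processing times (jobs
indexed `0,…,n-1` in arrival order).  Job `j` has size `p j > 0` and is of class
`c j` (meaning `2^(c j) ≤ p j < 2^(c j + 1)`); the instance is `Δ`-separated with
`Δ = log₂(1/ε) + 2`, i.e. all classes lie in `{k₀ + i·Δ : i ∈ ℤ}`.  The two-stage
algorithm works as follows.  Stage 1: an arriving job `j` is dispatched to the
machine `i ∈ S j` minimizing `loadC i (c j)`, the total size of class-`c j` jobs
dispatched to `i` so far, unless this quantity is at least `α·T*` on all machines
of `S j`, in which case the job is rejected (`α = 2·log₂(1/ε)+2`).  Stage 2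
(pruning, which does not affect Stage 1): whenever the total load on a machine
exceeds `2α·T*`, the largest jobs of its queue are removed until the load is at
most `2α·T*`; equivalently, a dispatched job `j` is still present at time `t` iff
the total size of strictly smaller (w.r.t. size, ties by index) jobs dispatched to
the same machine is `< 2α·T*`.  Assuming the offline optimum is at most the known
value `T*`, the algorithm is `O(log(1/ε))`-competitive and rejects at most an
`ε`-fraction of the jobs.
-/
theorem loadbalancing_delta_separated :
    ∃ C : ℝ, 0 < C ∧
    ∀ (n m : ℕ) (ε : ℝ), 0 < ε → ε < 1 →
    ∀ (Tstar α : ℝ) (Δ : ℕ)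
      (p : Fin n → ℝ) (c : Fin n → ℤ) (S : Fin n → Finset (Fin m))
      (assign : Fin n → Option (Fin m))
      (loadC : Fin m → ℤ → ℕ → ℝ) (kept : Fin n → ℕ → Prop) (load : Fin m → ℕ → ℝ),
      α = 2 * Real.logb 2 (1 / ε) + 2 →
      (Δ : ℝ) = Real.logb 2 (1 / ε) + 2 →
      (∀ j, 0 < p j) →
      (∀ j, (2 : ℝ) ^ (c j) ≤ p j ∧ p j < 2 ^ (c j + 1)) →
      -- the jobs are `Δ`-separated
      (∃ k₀ : ℤ, ∀ j, ∃ i : ℤ, c j = k₀ + i * (Δ : ℤ)) →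
      (∀ j, (S j).Nonempty) →
      (∀ j i, assign j = some i → i ∈ S j) →
      -- Stage-1 class loads
      (∀ i k t, loadC i k t =
        ∑ j ∈ (univ : Finset (Fin n)).filter
            (fun j : Fin n => (j : ℕ) < t ∧ assign j = some i ∧ c j = k), p j) →
      -- Stage-1 greedy dispatch / rejection rule
      (∀ j : Fin n, (∃ i ∈ S j, loadC i (c j) (j : ℕ) < α * Tstar) →
        ∃ i ∈ S j, assign j = some i ∧
          ∀ i' ∈ S j, loadC i (c j) (j : ℕ) ≤ loadC i' (c j) (j : ℕ)) →
      (∀ j : Fin n, assign j = none → ∀ i ∈ S j, α * Tstar ≤ loadC i (c j) (j : ℕ)) →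
      -- Stage-2 pruning: `j` is still present at time `t` iff the total size of the
      -- smaller jobs dispatched to the same machine so far is below `2α·T*`
      (∀ (j : Fin n) (t : ℕ), kept j t ↔
        ∃ i, assign j = some i ∧ (j : ℕ) < t ∧
          (∑ j' ∈ (univ : Finset (Fin n)).filter
              (fun j' : Fin n => (j' : ℕ) < t ∧ assign j' = some i ∧
                (p j' < p j ∨ (p j' = p j ∧ j' < j))), p j') < 2 * α * Tstar) →
      -- the actual load of a machine after pruning
      (∀ i t, load i t =
        ∑ j ∈ (univ : Finset (Fin n)).filter
            (fun j : Fin n => (j : ℕ) < t ∧ assign j = some i ∧ kept j t), p j) →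
      -- the offline optimum is at most `T*`
      (∃ opt : Fin n → Fin m, (∀ j, opt j ∈ S j) ∧
        ∀ i : Fin m,
          (∑ j ∈ (univ : Finset (Fin n)).filter (fun j => opt j = i), p j) ≤ Tstar) →
      -- conclusions: `O(log(1/ε))`-competitive, at most an `ε`-fraction rejected
      (∀ i t, load i t ≤ C * Real.logb 2 (1 / ε) * Tstar) ∧
      (∀ t : ℕ,
        (((univ : Finset (Fin n)).filter
            (fun j : Fin n => (j : ℕ) < t ∧ (assign j = none ∨ ¬ kept j t))).card : ℝ)
          ≤ ε * t) := by
  refine ⟨9, by norm_num, ?_⟩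
  intro n m ε hε hε1 T α Δ p c S assign loadC kept load hα hΔ hp hc hsep hSne hS hL hgreedy hrej
    hkept hload ⟨opt, hopt, hoptT⟩
  set L := Real.logb 2 (1 / ε) with hLdef
  have hLpos : 0 < L := Real.logb_pos (by norm_num) (by rw [lt_div_iff₀ hε]; linarith)
  have hΔ3 : 3 ≤ Δ := by
    have : (2 : ℝ) < Δ := by linarith
    exact_mod_cast this
  obtain ⟨q, rfl⟩ : ∃ q, Δ = q + 2 := ⟨Δ - 2, by omega⟩
  have hLq : L = q := by push_cast at hΔ; linarith
  have hq1 : 1 ≤ q := by omega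
  have hq1' : (1 : ℝ) ≤ q := by exact_mod_cast hq1
  have h2q : (2 : ℝ) ^ q = 1 / ε := by
    rw [← Real.rpow_natCast, ← hLq, hLdef, Real.rpow_logb (by norm_num) (by norm_num) (by positivity)]
  have hε2 : ε ≤ 1 / 2 := by
    have h1 : (2 : ℝ) ^ 1 ≤ 2 ^ q := pow_le_pow_right₀ (by norm_num) hq1
    rw [h2q, le_div_iff₀ hε] at h1
    linarith
  have h2Δ : (2 : ℝ) ^ (q + 2) = 4 / ε := by rw [pow_add, h2q]; ring
  rw [hLq] at hα ⊢
  have hα4 : 4 ≤ α := by linarith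
  have hpT : ∀ j, p j ≤ T := fun j =>
    (Finset.single_le_sum (f := p) (fun j _ => (hp j).le) (by simp : j ∈ univ.filter
      (fun j' => opt j' = opt j))).trans (hoptT (opt j))
  constructor
  · intro i t
    have hT0 : 0 ≤ T := (Finset.sum_nonneg (fun j _ => (hp j).le)).trans (hoptT i)
    rw [hload]
    set A := (univ : Finset (Fin n)).filter
            (fun j : Fin n => (j : ℕ) < t ∧ assign j = some i ∧ kept j t) with hA
    rcases A.eq_empty_or_nonempty with he | hne
    · rw [he, Finset.sum_empty]; positivity
    obtain ⟨j0, hj0, hmax⟩ := Finset.exists_max_image A (fun j => toLex (p j, j)) hne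
    rw [← Finset.sum_erase_add _ _ hj0]
    have hj0' := (mem_filter.1 hj0).2
    obtain ⟨i', hi', -, hsum⟩ := (hkept j0 t).1 hj0'.2.2
    rw [hj0'.2.1] at hi'
    obtain rfl := Option.some.inj hi'
    have h3 : ∑ j ∈ A.erase j0, p j ≤ ∑ j' ∈ (univ : Finset (Fin n)).filter
              (fun j' : Fin n => (j' : ℕ) < t ∧ assign j' = some i ∧
                (p j' < p j0 ∨ (p j' = p j0 ∧ j' < j0))), p j' := by
      apply Finset.sum_le_sum_of_subset_of_nonneg _ (fun j _ _ => (hp j).le)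
      intro j hj
      have h4 := Finset.mem_erase.1 hj
      have h5 := (mem_filter.1 h4.2).2
      refine mem_filter.2 ⟨mem_univ _, h5.1, h5.2.1, ?_⟩
      have h6 := hmax j h4.2
      rw [Prod.Lex.toLex_le_toLex] at h6
      rcases h6 with h6 | h6
      · exact Or.inl h6
      · exact Or.inr ⟨h6.1, lt_of_le_of_ne h6.2 h4.1⟩
    have h7 := hpT j0
    have h8 : 1 * T ≤ q * T := by gcongr
    rw [hα] at hsum
    linarith
  · intro t
    by_cases hn : ∃ j : Fin n, True
    swap
    · rw [Finset.filter_false_of_mem (fun j _ => absurd ⟨j, trivial⟩ hn)]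
      simp; positivity
    have hT : 0 < T := by
      obtain ⟨j, -⟩ := hn
      exact (hp j).trans_le (hpT j)
    set Jt := (univ : Finset (Fin n)).filter (fun j : Fin n => (j : ℕ) < t) with hJt
    obtain ⟨bad, hbad⟩ : ∃ bad : Fin n → Prop,
      bad = fun j => ∀ i ∈ S j, α * T ≤ loadC i (c j) j := ⟨_, rfl⟩
    set Rej := (univ : Finset (Fin n)).filter
            (fun j : Fin n => (j : ℕ) < t ∧ (assign j = none ∨ ¬ kept j t)) with hRej
    have hJtc : (Jt.card : ℝ) ≤ t := by
      have : Jt.card ≤ (range t).card := by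
        apply Finset.card_le_card_of_injOn (fun j : Fin n => (j : ℕ))
        · intro j hj; simpa [hJt] using hj
        · intro a _ b _ hab; exact Fin.ext hab
      rw [card_range] at this
      exact_mod_cast this
    -- stage 1
    have hbadc : ((Jt.filter bad).card : ℝ) ≤ ε / 2 * Jt.card := by
      have hcl : ∀ l : ℤ, (((Jt.filter bad).filter (fun j => c j = l)).card : ℝ) ≤
          ε / 2 * (Jt.filter (fun j => c j = l)).card := by
        intro l
        set N : ℝ → Finset (Fin n) := fun x => univ.filter (fun j : Fin n => (j : ℕ) < t ∧ c j = l ∧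
          ∀ i ∈ S j, x ≤ loadC i l j) with hN
        have hstep : ∀ k : ℕ, k ≤ q + 1 → 2 ^ k * (N (k * (2 * T))).card ≤ (N 0).card := by
          intro k
          induction k with
          | zero => intro _; simp
          | succ k ih =>
            intro hk
            have hk' : (k : ℝ) + 1 ≤ q + 1 := by exact_mod_cast hk
            have hh := LBaux.halve T α p c S assign loadC hp hc hS hL hgreedy opt hopt hoptT t l
              ((k + 1 : ℕ) * (2 * T)) (by push_cast; nlinarith [(Nat.cast_nonneg k : (0:ℝ) ≤ k)])
              (by rw [hα]; push_cast; nlinarith) N (fun x => rfl)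
            have e : ((k + 1 : ℕ) : ℝ) * (2 * T) - 2 * T = k * (2 * T) := by push_cast; ring
            rw [e] at hh
            have := ih (by omega)
            calc 2 ^ (k + 1) * (N ((k + 1 : ℕ) * (2 * T))).card
                = 2 ^ k * (2 * (N ((k + 1 : ℕ) * (2 * T))).card) := by ring
              _ ≤ 2 ^ k * (N (k * (2 * T))).card := Nat.mul_le_mul_left _ hh
              _ ≤ _ := this
        have h1 := hstep (q + 1) le_rfl
        have e : ((q + 1 : ℕ) : ℝ) * (2 * T) = α * T := by rw [hα]; push_cast; ring
        rw [e] at h1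
        have h2 : (Jt.filter bad).filter (fun j => c j = l) ⊆ N (α * T) := by
          intro j hj
          simp only [hJt, hbad, mem_filter, mem_univ, true_and, hN] at hj ⊢
          obtain ⟨⟨ha, hb⟩, rfl⟩ := hj
          exact ⟨ha, rfl, hb⟩
        have h3 : N 0 ⊆ Jt.filter (fun j => c j = l) := by
          intro j hj
          simp only [hJt, mem_filter, mem_univ, true_and, hN] at hj ⊢
          exact ⟨hj.1, hj.2.1⟩
        have h4 : (2 : ℝ) ^ (q + 1) * (N (α * T)).card ≤ (N 0).card := by exact_mod_cast h1
        have h5 : (((Jt.filter bad).filter (fun j => c j = l)).card : ℝ) ≤ (N (α * T)).card := by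
          exact_mod_cast Finset.card_le_card h2
        have h6 : ((N 0).card : ℝ) ≤ (Jt.filter (fun j => c j = l)).card := by
          exact_mod_cast Finset.card_le_card h3
        have e2 : ε / 2 * (2 : ℝ) ^ (q + 1) = 1 := by rw [pow_succ, h2q]; field_simp
        calc _ ≤ ((N (α * T)).card : ℝ) := h5
          _ = ε / 2 * ((2 : ℝ) ^ (q + 1) * (N (α * T)).card) := by rw [← mul_assoc, e2, one_mul]
          _ ≤ ε / 2 * (Jt.filter (fun j => c j = l)).card := by
            have := h4.trans h6
            gcongr
      rw [Finset.card_eq_sum_card_fiberwise (s := Jt.filter bad) (t := univ.image c) (f := c)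
          (fun j _ => by simp),
        Finset.card_eq_sum_card_fiberwise (s := Jt) (t := univ.image c) (f := c)
          (fun j _ => by simp)]
      push_cast
      rw [Finset.mul_sum]
      exact Finset.sum_le_sum (fun l _ => hcl l)
    -- stage 2
    have hnone : ((Rej.filter (fun j => assign j = none)).card : ℝ) ≤
        ((Jt.filter bad).filter (fun j => assign j = none)).card := by
      have : Rej.filter (fun j => assign j = none) ⊆
          (Jt.filter bad).filter (fun j => assign j = none) := by
        intro j hj
        simp only [hRej, hJt, hbad, mem_filter, mem_univ, true_and] at hj ⊢
        exact ⟨⟨hj.1.1, hrej j hj.2⟩, hj.2⟩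
      exact_mod_cast Finset.card_le_card this
    have hsome : ∀ i, ((Rej.filter (fun j => assign j = some i)).card : ℝ) ≤
        ((Jt.filter bad).filter (fun j => assign j = some i)).card +
          ε / 2 * (Jt.filter (fun j => assign j = some i)).card := by
      intro i
      have := LBaux.machine (Jt.filter (fun j => assign j = some i))
        (Rej.filter (fun j => assign j = some i)) bad p c T α ε (q + 2) hα4 hT hε hε2 h2Δ
        (by omega) hc hsep ?_ ?_ ?_
      · have hcm : (Jt.filter bad).filter (fun j => assign j = some i) =
            (Jt.filter (fun j => assign j = some i)).filter bad := by
          ext j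
          simp only [mem_filter]
          tauto
        rw [hcm]
        exact this
      · intro k
        have hlt := LBaux.pre_lt ((Jt.filter (fun j => assign j = some i)).filter
          (fun j => ¬ bad j ∧ c j = k))
          ((Jt.filter (fun j => assign j = some i)).filter (fun j => c j = k)) p hp (α * T) T
          (by positivity) hT ?_ ?_ (fun j _ => hpT j)
        · rw [add_mul, one_mul]
          exact hlt.le
        · intro j hj
          simp only [mem_filter] at hj ⊢
          tauto
        · intro j hj
          simp only [hJt, mem_filter, mem_univ, true_and] at hj
          obtain ⟨⟨hjt, hji⟩, hnb, rfl⟩ := hj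
          simp only [hbad, not_forall, not_le] at hnb
          obtain ⟨i1, hi1, hlt1⟩ := hnb
          obtain ⟨i2, -, hi2, hmin⟩ := hgreedy j ⟨i1, hi1, hlt1⟩
          rw [hji] at hi2
          obtain rfl := Option.some.inj hi2
          refine lt_of_le_of_lt ?_ ((hmin i1 hi1).trans_lt hlt1)
          rw [hL]
          apply Finset.sum_le_sum_of_subset_of_nonneg _ (fun j _ _ => (hp j).le)
          intro j' hj'
          simp only [hJt, mem_filter, mem_univ, true_and, Fin.lt_def] at hj' ⊢
          tauto
      · intro j hj
        simp only [hRej, hJt, mem_filter, mem_univ, true_and] at hj ⊢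
        exact ⟨hj.1.1, hj.2⟩
      · intro j hj
        simp only [hRej, mem_filter, mem_univ, true_and] at hj
        have hnk : ¬ kept j t := by
          rcases hj.1.2 with h | h
          · rw [hj.2] at h; exact absurd h (by simp)
          · exact h
        rw [hkept] at hnk
        by_contra hcon
        rw [not_le] at hcon
        refine hnk ⟨i, hj.2, hj.1.1, lt_of_le_of_lt (le_of_eq ?_) hcon⟩
        congr 1
        ext j'
        simp only [hJt, mem_filter, mem_univ, true_and]
        tauto
    have e1 := LBaux.card_opt Rej assign
    have e2 := LBaux.card_opt (Jt.filter bad) assign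
    have e3 := LBaux.card_opt Jt assign
    have e1' : (Rej.card : ℝ) = (Rej.filter (fun j => assign j = none)).card +
      ∑ i, ((Rej.filter (fun j => assign j = some i)).card : ℝ) := by exact_mod_cast e1
    have e2' : ((Jt.filter bad).card : ℝ) = ((Jt.filter bad).filter (fun j => assign j = none)).card +
      ∑ i, (((Jt.filter bad).filter (fun j => assign j = some i)).card : ℝ) := by exact_mod_cast e2
    have e3' : (Jt.card : ℝ) = (Jt.filter (fun j => assign j = none)).card +
      ∑ i, ((Jt.filter (fun j => assign j = some i)).card : ℝ) := by exact_mod_cast e3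
    have hs := Finset.sum_le_sum (fun i (_ : i ∈ (univ : Finset (Fin m))) => hsome i)
    rw [Finset.sum_add_distrib, ← Finset.mul_sum] at hs
    have h0 : (0 : ℝ) ≤ (Jt.filter (fun j => assign j = none)).card := by positivity
    have hfin : (Rej.card : ℝ) ≤ (Jt.filter bad).card + ε / 2 * Jt.card := by
      rw [e1', e2', e3']
      nlinarith
    have : ε * Jt.card ≤ ε * t := by gcongr
    linarith
end

section
/- Assume the value of the offline optimum of a restricted-assignment LoadBalancing instance with arbitrary job sizes is at most T*. Partitioning the jobs into Δ = log(1/ε)+2 groups, each of which is Δ-separated, and running the Δ-separated two-stage algorithm independently on each group, the resulting algorithm assigns load at most O(log²(1/ε))·T* on every machine and rejects at most an ε-fraction of the jobs. -/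
open Finset
open scoped Classical

lemma lbFiberLe {ι κ : Type*} [DecidableEq κ] (s : Finset ι) (f : ι → κ) (u v : ι → ℝ)
    (h : ∀ b, ∑ j ∈ s.filter (fun j => f j = b), u j ≤ ∑ j ∈ s.filter (fun j => f j = b), v j) :
    ∑ j ∈ s, u j ≤ ∑ j ∈ s, v j := by
  have hm : ∀ x ∈ s, f x ∈ s.image f := fun x hx => mem_image_of_mem f hx
  rw [← sum_fiberwise_of_maps_to hm u, ← sum_fiberwise_of_maps_to hm v]
  exact sum_le_sum fun b _ => h b

/-- jobs started below `h` have total volume at most `h + s` -/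
lemma lbStartUpper {ι : Type*} [LinearOrder ι] (J : Finset ι) (p : ι → ℝ) (h s : ℝ)
    (hp : ∀ j ∈ J, 0 ≤ p j) (hs : ∀ j ∈ J, p j ≤ s) (h0 : 0 ≤ h + s) (B : Finset ι)
    (hB : B ⊆ J) (hlt : ∀ j ∈ B, ∑ j' ∈ J.filter (fun j' => j' < j), p j' ≤ h) :
    ∑ j ∈ B, p j ≤ h + s := by
  rcases B.eq_empty_or_nonempty with rfl | hne
  · simpa using h0
  · have hm := B.max'_mem hne
    set j := B.max' hne
    rw [← sum_erase_add _ _ hm]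
    have h1 : ∑ x ∈ B.erase j, p x ≤ ∑ j' ∈ J.filter (fun j' => j' < j), p j' := by
      apply sum_le_sum_of_subset_of_nonneg
      · intro x hx
        rw [mem_erase] at hx
        exact mem_filter.2 ⟨hB hx.2, lt_of_le_of_ne (B.le_max' x hx.2) hx.1⟩
      · intro x hx _
        exact hp x (mem_filter.1 hx).1
    have := hlt j hm
    have := hs j (hB hm)
    linarith

lemma lbStartLower {ι : Type*} [LinearOrder ι] (J : Finset ι) (p : ι → ℝ) (h : ℝ)
    (hp : ∀ j ∈ J, 0 ≤ p j) (hJ : h ≤ ∑ j ∈ J, p j) :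
    h ≤ ∑ j ∈ J.filter (fun j => ∑ j' ∈ J.filter (fun j' => j' < j), p j' < h), p j := by
  set B := J.filter (fun j => ¬ ∑ j' ∈ J.filter (fun j' => j' < j), p j' < h) with hB
  rcases B.eq_empty_or_nonempty with he | hne
  · rw [filter_true_of_mem]
    · exact hJ
    · intro j hj
      by_contra hc
      have : j ∈ B := mem_filter.2 ⟨hj, hc⟩
      simp [he] at this
  · have hm := B.min'_mem hne
    set j := B.min' hne with hjdef
    have h1 := (mem_filter.1 hm).2
    push Not at h1
    refine h1.trans ?_
    apply sum_le_sum_of_subset_of_nonneg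
    · intro x hx
      rw [mem_filter] at hx
      refine mem_filter.2 ⟨hx.1, ?_⟩
      by_contra hc
      have : x ∈ B := mem_filter.2 ⟨hx.1, hc⟩
      exact absurd (B.min'_le x this) (not_le.2 hx.2)
    · intro x hx _
      exact hp x (mem_filter.1 hx).1

lemma lbGeom (k : ℤ) (F : Finset ℤ) (hF : ∀ x ∈ F, k < x) :
    ∑ x ∈ F, (2 : ℝ) ^ (-x) ≤ 2 ^ (-k) := by
  have key : ∀ N : ℕ, ∑ r ∈ range N, (2 : ℝ) ^ (-(k + 1 + (r : ℤ))) = 2 ^ (-k) - 2 ^ (-(k + N)) := by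
    intro N
    induction N with
    | zero => simp
    | succ N ih =>
      rw [sum_range_succ, ih]
      have : (2 : ℝ) ^ (-(k + (N : ℤ))) = 2 * 2 ^ (-(k + 1 + (N : ℤ))) := by
        rw [← zpow_one_add₀ (by norm_num)]
        congr 1; ring
      have h2 : (-(k + ((N + 1 : ℕ) : ℤ))) = -(k + 1 + (N : ℤ)) := by push_cast; ring
      rw [h2, this]; ring
  obtain ⟨M, hM⟩ : ∃ M, ∀ x ∈ F, x ≤ M := F.bddAbove.imp fun M h x hx => h hx
  have hle : ∑ x ∈ F, (2 : ℝ) ^ (-x) ≤ ∑ r ∈ range (M - k).toNat, (2 : ℝ) ^ (-(k + 1 + (r : ℤ))) := by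
    have hinj : Set.InjOn (fun r : ℕ => k + 1 + (r : ℤ)) (range (M - k).toNat : Set ℕ) := by
      intro a _ b _ h
      simp at h; exact h
    have := sum_image (f := fun x : ℤ => (2 : ℝ) ^ (-x)) hinj
    rw [← this]
    apply sum_le_sum_of_subset_of_nonneg
    · intro x hx
      have := hF x hx
      have := hM x hx
      refine mem_image.2 ⟨(x - k - 1).toNat, ?_, ?_⟩
      · rw [mem_range]; omega
      · omega
    · intro x _ _; positivity
  rw [key] at hle
  have : (0 : ℝ) < 2 ^ (-(k + (((M - k).toNat : ℕ) : ℤ))) := by positivity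
  linarith

lemma lbPrune {ι : Type*} [LinearOrder ι] (J : Finset ι) (p : ι → ℝ) (c : ι → ℤ) (R low : ι → Prop)
    (T α ε : ℝ) (Δ : ℕ) (hα : 4 ≤ α) (hε : 0 < ε) (hΔ3 : 3 ≤ Δ) (hΔ : ε * 2 ^ (Δ : ℤ) = 4)
    (hc : ∀ j, (2 : ℝ) ^ (c j) ≤ p j ∧ p j < 2 ^ (c j + 1))
    (hpT : ∀ j, p j ≤ T) (hlow : ∀ j, (2 : ℝ) ^ (c j + Δ) ≤ T → low j)
    (hgrp : ∀ j ∈ J, ∀ j' ∈ J, c j' < c j → c j' + Δ ≤ c j)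
    (hload : ∀ k, ∑ j ∈ J.filter (fun j => ¬ R j ∧ c j = k), p j ≤ (α + 1) * T) :
    ((J.filter (fun j => 2 * α * T ≤ ∑ j' ∈ J.filter
        (fun j' => p j' < p j ∨ (p j' = p j ∧ j' < j)), p j')).card : ℝ)
      ≤ ((J.filter R).card : ℝ) + ε / 2 * ((J.filter low).card : ℝ) := by
  set P := J.filter (fun j => 2 * α * T ≤ ∑ j' ∈ J.filter
        (fun j' => p j' < p j ∨ (p j' = p j ∧ j' < j)), p j') with hP
  rcases P.eq_empty_or_nonempty with he | hne
  · rw [he]; simp only [card_empty, Nat.cast_zero]; positivity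
  obtain ⟨j0, hj0, hmin⟩ := P.exists_min_image (fun j => toLex (p j, j)) hne
  have hj0J := (mem_filter.1 hj0).1
  have hpre := (mem_filter.1 hj0).2
  set lt0 : ι → Prop := fun j => p j < p j0 ∨ (p j = p j0 ∧ j < j0) with hlt0
  have hpos : ∀ j, 0 < p j := fun j => lt_of_lt_of_le (by positivity) (hc j).1
  have hT : 0 < T := (hpos j0).trans_le (hpT j0)
  have hge : ∀ j, ¬ lt0 j → p j0 ≤ p j := by
    intro j h; simp only [hlt0, not_or] at h; exact not_lt.1 h.1
  have hle : ∀ j, lt0 j → p j ≤ p j0 := by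
    rintro j (h | h)
    · exact h.le
    · exact h.1.le
  have hPU : P ⊆ J.filter (fun j => ¬ lt0 j) := by
    intro j hj
    refine mem_filter.2 ⟨(mem_filter.1 hj).1, fun hl => ?_⟩
    have := hmin j hj
    rw [← not_lt, Prod.Lex.toLex_lt_toLex] at this
    exact this hl
  have classmono : ∀ a b, p a ≤ p b → c a ≤ c b := by
    intro a b hab
    have h1 : (2 : ℝ) ^ (c a) < 2 ^ (c b + 1) := ((hc a).1.trans hab).trans_lt (hc b).2
    have := (zpow_lt_zpow_iff_right₀ (by norm_num : (1 : ℝ) < 2)).1 h1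
    omega
  set p0 := p j0 with hp0
  set k0 := c j0 with hk0
  have hp0pos : 0 < p0 := hpos j0
  -- the pieces
  set Z := J.filter (fun j => ¬ lt0 j ∧ ¬ R j ∧ c j = k0) with hZ
  set H := J.filter (fun j => ¬ lt0 j ∧ ¬ R j ∧ c j ≠ k0) with hH
  set UR := J.filter (fun j => ¬ lt0 j ∧ R j) with hUR
  set KR := J.filter (fun j => lt0 j ∧ R j) with hKR
  set Y := J.filter (fun j => lt0 j ∧ ¬ R j ∧ c j = k0) with hY
  set X := J.filter (fun j => lt0 j ∧ ¬ R j ∧ c j ≠ k0) with hX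
  have hcardU : (P.card : ℝ) ≤ UR.card + Z.card + H.card := by
    have : P ⊆ UR ∪ Z ∪ H := by
      intro j hj
      have h := mem_filter.1 (hPU hj)
      simp only [hUR, hZ, hH, mem_union, mem_filter]
      tauto
    have h1 := card_le_card this
    have h2 := card_union_le (UR ∪ Z) H
    have h3 := card_union_le UR Z
    exact_mod_cast (by omega : P.card ≤ UR.card + Z.card + H.card)
  have hcardR : ((J.filter R).card : ℝ) = UR.card + KR.card := by
    rw [← card_filter_add_card_filter_not (s := J.filter R) lt0, filter_filter, filter_filter]
    rw [add_comm, hUR, hKR]; push_cast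
    congr 3 <;> (ext j; simp; try tauto)
  have hsumK : 2 * α * T ≤ ∑ j ∈ X, p j + ∑ j ∈ Y, p j + ∑ j ∈ KR, p j := by
    refine hpre.trans (le_of_eq ?_)
    change ∑ j ∈ J.filter lt0, p j = _
    rw [← sum_filter_add_sum_filter_not (J.filter lt0) R, filter_filter, filter_filter,
      ← sum_filter_add_sum_filter_not (J.filter (fun j => lt0 j ∧ ¬ R j)) (fun j => c j = k0),
      filter_filter, filter_filter]
    simp only [and_assoc]
    rw [hX, hY, hKR]; ring
  have hYZ : ∑ j ∈ Y, p j + ∑ j ∈ Z, p j ≤ (α + 1) * T := by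
    refine le_trans (le_of_eq ?_) (hload k0)
    rw [← sum_filter_add_sum_filter_not (J.filter (fun j => ¬ R j ∧ c j = k0)) lt0,
      filter_filter, filter_filter, hY, hZ]
    congr 2 <;> (ext j; simp; try tauto)
  have hZc : p0 * Z.card ≤ ∑ j ∈ Z, p j := by
    rw [mul_comm, ← nsmul_eq_mul]
    exact card_nsmul_le_sum _ _ _ fun j hj => hge j (mem_filter.1 hj).2.1
  have hKRc : ∑ j ∈ KR, p j ≤ p0 * KR.card := by
    rw [mul_comm, ← nsmul_eq_mul]
    exact sum_le_card_nsmul _ _ _ fun j hj => hle j (mem_filter.1 hj).2.1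
  have hXclass : ∀ j ∈ X, c j + Δ ≤ k0 := by
    intro j hj
    have h := mem_filter.1 hj
    have := classmono j j0 (hle j h.2.1)
    exact hgrp j0 hj0J j h.1 (lt_of_le_of_ne this h.2.2.2)
  have h2Δ : (2 : ℝ) ^ (-(Δ : ℤ)) = ε / 4 := by
    rw [zpow_neg]
    have : (0 : ℝ) < 2 ^ (Δ : ℤ) := by positivity
    rw [← hΔ]; field_simp
  have hXc : ∑ j ∈ X, p j ≤ p0 * (ε / 2) * X.card := by
    rw [mul_comm, ← nsmul_eq_mul]
    refine sum_le_card_nsmul _ _ _ fun j hj => ?_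
    have h1 := hXclass j hj
    have h2 : (2 : ℝ) ^ (c j + 1) ≤ 2 ^ (k0 + (-(Δ : ℤ)) + 1) :=
      zpow_le_zpow_right₀ (by norm_num) (by omega)
    rw [zpow_add₀ (by norm_num) (c j), zpow_add₀ (by norm_num) (k0 + -(Δ : ℤ)),
      zpow_add₀ (by norm_num) k0, h2Δ] at h2
    have h3 := (hc j).2.le
    rw [zpow_add₀ (by norm_num)] at h3
    have h4 : (2 : ℝ) ^ k0 * (ε / 4) * 2 ^ (1 : ℤ) ≤ p0 * (ε / 2) := by
      have := mul_le_mul_of_nonneg_right (hc j0).1 (by positivity : 0 ≤ ε / 2)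
      rw [zpow_one]; linarith
    linarith
  have hXlow : (X.card : ℝ) ≤ (J.filter low).card := by
    have : X ⊆ J.filter low := by
      intro j hj
      refine mem_filter.2 ⟨(mem_filter.1 hj).1, hlow j ?_⟩
      have h2 : (2 : ℝ) ^ (c j + Δ) ≤ 2 ^ k0 :=
        zpow_le_zpow_right₀ (by norm_num) (hXclass j hj)
      exact h2.trans ((hc j0).1.trans (hpT j0))
    exact_mod_cast card_le_card this
  have hHclass : ∀ j ∈ H, k0 + 2 < c j := by
    intro j hj
    have h := mem_filter.1 hj
    have := classmono j0 j (hge j h.2.1)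
    have := hgrp j h.1 j0 hj0J (lt_of_le_of_ne this (Ne.symm h.2.2.2))
    omega
  have hHc : p0 * H.card ≤ (α + 1) * T / 2 := by
    have h1 : (H.card : ℝ) ≤ ∑ j ∈ H, p j * 2 ^ (-(c j)) := by
      rw [card_eq_sum_ones]; push_cast
      refine sum_le_sum fun j _ => ?_
      have : (0 : ℝ) < 2 ^ (c j) := by positivity
      rw [zpow_neg, ← div_eq_mul_inv, le_div_iff₀ this, one_mul]
      exact (hc j).1
    have h2 : ∑ j ∈ H, p j * (2 : ℝ) ^ (-(c j)) ≤ ∑ k ∈ H.image c, (α + 1) * T * 2 ^ (-k) := by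
      rw [← sum_fiberwise_of_maps_to (fun x hx => mem_image_of_mem c hx)]
      refine sum_le_sum fun k _ => ?_
      have : ∑ j ∈ H.filter (fun j => c j = k), p j * (2 : ℝ) ^ (-(c j))
          = (∑ j ∈ H.filter (fun j => c j = k), p j) * 2 ^ (-k) := by
        rw [sum_mul]
        refine sum_congr rfl fun j hj => ?_
        rw [(mem_filter.1 hj).2]
      rw [this]
      refine mul_le_mul_of_nonneg_right (le_trans ?_ (hload k)) (by positivity)
      apply sum_le_sum_of_subset_of_nonneg
      · intro j hj
        simp only [hH, mem_filter] at hj ⊢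
        tauto
      · intro j _ _; exact (hpos j).le
    rw [← mul_sum] at h2
    have h3 := lbGeom (k0 + 2) (H.image c) (by
      intro x hx
      obtain ⟨j, hj, rfl⟩ := mem_image.1 hx
      exact hHclass j hj)
    have h4 : (H.card : ℝ) ≤ (α + 1) * T * 2 ^ (-(k0 + 2)) :=
      h1.trans (h2.trans (mul_le_mul_of_nonneg_left h3 (by positivity)))
    have h5 : p0 * 2 ^ (-(k0 + 2)) ≤ 1 / 2 := by
      have h6 := (hc j0).2.le
      have h7 : (2 : ℝ) ^ (k0 + 1) * 2 ^ (-(k0 + 2)) = 1 / 2 := by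
        rw [← zpow_add₀ (by norm_num)]
        have : k0 + 1 + -(k0 + 2) = -1 := by ring
        rw [this]; norm_num
      rw [← h7]
      exact mul_le_mul_of_nonneg_right h6 (by positivity)
    have h8 := mul_le_mul_of_nonneg_left h4 hp0pos.le
    have h9 := mul_le_mul_of_nonneg_left h5 (by positivity : 0 ≤ (α + 1) * T)
    linarith
  have hmain : p0 * (Z.card + H.card : ℝ) ≤ p0 * (KR.card + ε / 2 * X.card) := by
    have : 4 * T ≤ α * T := mul_le_mul_of_nonneg_right hα hT.le
    nlinarith
  have hmain' := le_of_mul_le_mul_left hmain hp0pos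
  have := mul_le_mul_of_nonneg_left hXlow (by positivity : 0 ≤ ε / 2)
  linarith

lemma lbStage1Step {n m : ℕ} (p : Fin n → ℝ) (c : Fin n → ℤ) (S : Fin n → Finset (Fin m))
    (assign : Fin n → Option (Fin m)) (loadC : Fin m → ℤ → ℕ → ℝ) (A T s : ℝ) (k : ℤ) (t : ℕ)
    (hp : ∀ j, 0 < p j)
    (hC : ∀ i k t, loadC i k t =
        ∑ j ∈ (univ : Finset (Fin n)).filter
            (fun j : Fin n => (j : ℕ) < t ∧ assign j = some i ∧ c j = k), p j)
    (hS : ∀ j i, assign j = some i → i ∈ S j)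
    (hgreedy : ∀ j : Fin n, (∃ i ∈ S j, loadC i (c j) (j : ℕ) < A) →
        ∃ i ∈ S j, assign j = some i ∧
          ∀ i' ∈ S j, loadC i (c j) (j : ℕ) ≤ loadC i' (c j) (j : ℕ))
    (opt : Fin n → Fin m) (hopt : ∀ j, opt j ∈ S j)
    (hoptT : ∀ i : Fin m,
          (∑ j ∈ (univ : Finset (Fin n)).filter (fun j => opt j = i), p j) ≤ T)
    (hs : ∀ j, c j = k → p j ≤ s) (hs0 : 0 ≤ s) (h : ℝ) (hh : 0 ≤ h - (T + s)) (hA : h ≤ A) :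
    2 * ∑ j ∈ (univ : Finset (Fin n)).filter
        (fun j : Fin n => (j : ℕ) < t ∧ c j = k ∧ ∀ i ∈ S j, h ≤ loadC i k j), p j
      ≤ ∑ j ∈ (univ : Finset (Fin n)).filter
        (fun j : Fin n => (j : ℕ) < t ∧ c j = k ∧ ∀ i ∈ S j, h - (T + s) ≤ loadC i k j), p j := by
  set W := (univ : Finset (Fin n)).filter
        (fun j : Fin n => (j : ℕ) < t ∧ c j = k ∧ ∀ i ∈ S j, h ≤ loadC i k j) with hW
  set W' := (univ : Finset (Fin n)).filter
        (fun j : Fin n => (j : ℕ) < t ∧ c j = k ∧ ∀ i ∈ S j, h - (T + s) ≤ loadC i k j) with hW'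
  set M := (univ : Finset (Fin m)).filter (fun i => h ≤ loadC i k t) with hM
  have hmono : ∀ i (a b : ℕ), a ≤ b → loadC i k a ≤ loadC i k b := by
    intro i a b hab
    rw [hC, hC]
    apply sum_le_sum_of_subset_of_nonneg
    · intro j hj
      simp only [mem_filter] at hj ⊢
      exact ⟨hj.1, hj.2.1.trans_le hab, hj.2.2⟩
    · intro j _ _; exact (hp j).le
  have h1 : ∑ j ∈ W, p j ≤ M.card * T := by
    have hm : ∀ j ∈ W, opt j ∈ M := by
      intro j hj
      simp only [hW, mem_filter] at hj
      refine mem_filter.2 ⟨mem_univ _, ?_⟩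
      exact (hj.2.2.2 _ (hopt j)).trans (hmono _ _ _ hj.2.1.le)
    rw [← sum_fiberwise_of_maps_to hm, ← nsmul_eq_mul]
    refine sum_le_card_nsmul _ _ _ fun i _ => le_trans ?_ (hoptT i)
    apply sum_le_sum_of_subset_of_nonneg
    · exact filter_subset_filter _ (subset_univ _)
    · intro j _ _; exact (hp j).le
  -- jobs on machine i
  set J : Fin m → Finset (Fin n) := fun i => (univ : Finset (Fin n)).filter
            (fun j : Fin n => (j : ℕ) < t ∧ assign j = some i ∧ c j = k) with hJ
  have hstart : ∀ i, ∀ j ∈ J i, ∑ j' ∈ (J i).filter (fun j' => j' < j), p j' = loadC i k j := by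
    intro i j hj
    rw [hC, hJ, filter_filter]
    simp only [hJ, mem_filter] at hj
    apply sum_congr _ fun _ _ => rfl
    ext x
    simp only [mem_filter, Fin.lt_def]
    constructor
    · rintro ⟨a, ⟨b, d⟩, e⟩; exact ⟨a, e, d⟩
    · rintro ⟨a, e, d⟩; exact ⟨a, ⟨e.trans hj.2.1, d⟩, e⟩
  have h2 : (M.card : ℝ) * T ≤ ∑ j ∈ W' \ W, p j := by
    set G : Fin m → Finset (Fin n) := fun i => (J i).filter
      (fun j => loadC i k j < h ∧ h - (T + s) ≤ loadC i k j) with hG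
    have hGv : ∀ i ∈ M, T ≤ ∑ j ∈ G i, p j := by
      intro i hi
      have hi' : h ≤ ∑ j ∈ J i, p j := by
        have := (mem_filter.1 hi).2
        rwa [hC] at this
      have l1 := lbStartLower (J i) p h (fun j _ => (hp j).le) hi'
      rw [filter_congr (q := fun j : Fin n => loadC i k j < h)
        (fun j hj => by rw [hstart i j hj])] at l1
      have l2 := lbStartUpper (J i) p (h - (T + s)) s (fun j _ => (hp j).le)
        (fun j hj => hs j (mem_filter.1 hj).2.2.2) (by linarith)
        ((J i).filter (fun j : Fin n => loadC i k j < h ∧ ¬ h - (T + s) ≤ loadC i k j))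
        (filter_subset _ _) (by
          intro j hj
          rw [mem_filter] at hj
          rw [hstart i j hj.1]
          exact (not_le.1 hj.2.2).le)
      rw [← sum_filter_add_sum_filter_not _ (fun j : Fin n => h - (T + s) ≤ loadC i k j),
        filter_filter _ _ (J i), filter_filter _ _ (J i)] at l1
      simp only [hG]
      linarith
    have hdisj : (M : Set (Fin m)).PairwiseDisjoint G := by
      intro a _ b _ hab
      rw [Function.onFun, disjoint_left]
      intro j hja hjb
      simp only [hG, hJ, mem_filter] at hja hjb
      have := hja.1.2.2.1.symm.trans hjb.1.2.2.1
      exact hab (Option.some.inj this)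
    calc (M.card : ℝ) * T ≤ ∑ i ∈ M, ∑ j ∈ G i, p j := by
          rw [← nsmul_eq_mul]; exact card_nsmul_le_sum _ _ _ hGv
      _ = ∑ j ∈ M.biUnion G, p j := (sum_biUnion hdisj).symm
      _ ≤ _ := by
        apply sum_le_sum_of_subset_of_nonneg
        · intro j hj
          obtain ⟨i, hi, hj⟩ := mem_biUnion.1 hj
          simp only [hG, hJ, mem_filter] at hj
          obtain ⟨⟨_, hjt, hja, hjc⟩, hlt, hge⟩ := hj
          have hiS := hS j i hja
          rw [mem_sdiff]
          constructor
          · refine mem_filter.2 ⟨mem_univ _, hjt, hjc, ?_⟩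
            obtain ⟨i2, _, hi2a, hi2⟩ := hgreedy j ⟨i, hiS, by rw [hjc]; linarith⟩
            have : i2 = i := Option.some.inj (hi2a.symm.trans hja)
            subst this
            intro i' hi'
            have := hi2 i' hi'
            rw [hjc] at this
            linarith
          · intro hw
            have := (mem_filter.1 hw).2.2.2 i hiS
            linarith
        · intro j _ _; exact (hp j).le
  have hsub : W ⊆ W' := by
    intro j hj
    rw [mem_filter] at hj
    refine mem_filter.2 ⟨hj.1, hj.2.1, hj.2.2.1, fun i hi => ?_⟩
    have := hj.2.2.2 i hi
    have := (sum_nonneg (fun j _ => (hp j).le)).trans (hoptT (opt j))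
    linarith
  have h3 := sum_sdiff (f := p) hsub
  linarith

lemma lbStage1 {n m : ℕ} (p : Fin n → ℝ) (c : Fin n → ℤ) (S : Fin n → Finset (Fin m))
    (assign : Fin n → Option (Fin m)) (loadC : Fin m → ℤ → ℕ → ℝ) (A T s : ℝ) (k : ℤ) (t : ℕ)
    (hp : ∀ j, 0 < p j)
    (hc : ∀ j, (2 : ℝ) ^ (c j) ≤ p j ∧ p j < 2 ^ (c j + 1))
    (hC : ∀ i k t, loadC i k t =
        ∑ j ∈ (univ : Finset (Fin n)).filter
            (fun j : Fin n => (j : ℕ) < t ∧ assign j = some i ∧ c j = k), p j)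
    (hS : ∀ j i, assign j = some i → i ∈ S j)
    (hgreedy : ∀ j : Fin n, (∃ i ∈ S j, loadC i (c j) (j : ℕ) < A) →
        ∃ i ∈ S j, assign j = some i ∧
          ∀ i' ∈ S j, loadC i (c j) (j : ℕ) ≤ loadC i' (c j) (j : ℕ))
    (opt : Fin n → Fin m) (hopt : ∀ j, opt j ∈ S j)
    (hoptT : ∀ i : Fin m,
          (∑ j ∈ (univ : Finset (Fin n)).filter (fun j => opt j = i), p j) ≤ T)
    (hs : ∀ j, c j = k → p j ≤ s) (hs0 : 0 ≤ s) (hT : 0 ≤ T) (R : ℕ) (hR : R * (T + s) ≤ A) :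
    2 ^ R * (((univ : Finset (Fin n)).filter
        (fun j : Fin n => (j : ℕ) < t ∧ c j = k ∧ ∀ i ∈ S j, A ≤ loadC i k j)).card : ℝ)
      ≤ 2 * (((univ : Finset (Fin n)).filter
        (fun j : Fin n => (j : ℕ) < t ∧ c j = k)).card : ℝ) := by
  set V : ℝ → ℝ := fun h => ∑ j ∈ (univ : Finset (Fin n)).filter
        (fun j : Fin n => (j : ℕ) < t ∧ c j = k ∧ ∀ i ∈ S j, h ≤ loadC i k j), p j with hV
  have hTs : 0 ≤ T + s := by linarith
  have key : ∀ r : ℕ, r ≤ R → 2 ^ r * V A ≤ V (A - r * (T + s)) := by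
    intro r
    induction r with
    | zero => intro _; simp
    | succ r ih =>
      intro hr
      have ih' := ih (by omega)
      have h1 : ((r + 1 : ℕ) : ℝ) * (T + s) ≤ R * (T + s) :=
        mul_le_mul_of_nonneg_right (by exact_mod_cast hr) hTs
      have h2 : 0 ≤ (r : ℝ) * (T + s) := by positivity
      push_cast at h1
      have := lbStage1Step p c S assign loadC A T s k t hp hC hS hgreedy opt hopt hoptT hs hs0
        (A - r * (T + s)) (by linarith) (by linarith)
      have e : A - ((r + 1 : ℕ) : ℝ) * (T + s) = A - r * (T + s) - (T + s) := by push_cast; ring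
      rw [e, pow_succ]
      have h3 : 2 * V (A - r * (T + s)) ≤ V (A - r * (T + s) - (T + s)) := this
      linarith
  have h1 := key R le_rfl
  have h2 : V (A - R * (T + s)) ≤ (((univ : Finset (Fin n)).filter
        (fun j : Fin n => (j : ℕ) < t ∧ c j = k)).card : ℝ) * 2 ^ (k + 1) := by
    refine le_trans ?_ ((sum_le_card_nsmul _ p (2 ^ (k + 1)) ?_).trans_eq (nsmul_eq_mul _ _))
    · apply sum_le_sum_of_subset_of_nonneg
      · intro j hj
        rw [mem_filter] at hj ⊢
        exact ⟨hj.1, hj.2.1, hj.2.2.1⟩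
      · intro j _ _; exact (hp j).le
    · intro j hj
      have := (hc j).2.le
      rwa [(mem_filter.1 hj).2.2] at this
  have h3 : (((univ : Finset (Fin n)).filter
        (fun j : Fin n => (j : ℕ) < t ∧ c j = k ∧ ∀ i ∈ S j, A ≤ loadC i k j)).card : ℝ) * 2 ^ k
        ≤ V A := by
    rw [← nsmul_eq_mul]
    refine card_nsmul_le_sum _ _ _ fun j hj => ?_
    have := (hc j).1
    rwa [(mem_filter.1 hj).2.2.1] at this
  have hk : (0 : ℝ) < 2 ^ k := by positivity
  have h4 := mul_le_mul_of_nonneg_left h3 (by positivity : (0 : ℝ) ≤ 2 ^ R)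
  rw [zpow_add_one₀ (by norm_num)] at h2
  refine le_of_mul_le_mul_right ?_ hk
  linarith

/-!
Online restricted-assignment `LoadBalancing` with arbitrary job sizes (jobs indexed
`0,…,n-1` in arrival order).  Job `j` has size `p j > 0` and class `c j`
(`2^(c j) ≤ p j < 2^(c j + 1)`).  The jobs are partitioned into `Δ = log₂(1/ε)+2`
groups according to `c j mod Δ`; each group is `Δ`-separated, and the two-stage
algorithm of the `Δ`-separated case is run independently on each group:
Stage 1 dispatches an arriving job `j` to the machine `i ∈ S j` minimizing the total
size of class-`c j` jobs dispatched to `i`, rejecting it iff this is at least `α·T*`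
on all machines of `S j` (`α = 2·log₂(1/ε)+2`); Stage 2 prunes, within each group,
a machine's queue down to total group-load `2α·T*` by removing largest jobs.
If the offline optimum is at most `T*`, the resulting algorithm assigns load at most
`O(log²(1/ε))·T*` on every machine and rejects at most an `ε`-fraction of the jobs.
-/
theorem loadbalancing_general_sizes :
    ∃ C : ℝ, 0 < C ∧
    ∀ (n m : ℕ) (ε : ℝ), 0 < ε → ε < 1 →
    ∀ (Tstar α : ℝ) (Δ : ℕ), 0 < Δ →
    ∀ (p : Fin n → ℝ) (c : Fin n → ℤ) (S : Fin n → Finset (Fin m))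
      (assign : Fin n → Option (Fin m))
      (loadC : Fin m → ℤ → ℕ → ℝ) (kept : Fin n → ℕ → Prop) (load : Fin m → ℕ → ℝ),
      α = 2 * Real.logb 2 (1 / ε) + 2 →
      (Δ : ℝ) = Real.logb 2 (1 / ε) + 2 →
      (∀ j, 0 < p j) →
      (∀ j, (2 : ℝ) ^ (c j) ≤ p j ∧ p j < 2 ^ (c j + 1)) →
      (∀ j, (S j).Nonempty) →
      (∀ j i, assign j = some i → i ∈ S j) →
      -- Stage-1 class loads
      (∀ i k t, loadC i k t =
        ∑ j ∈ (univ : Finset (Fin n)).filter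
            (fun j : Fin n => (j : ℕ) < t ∧ assign j = some i ∧ c j = k), p j) →
      -- Stage-1 greedy dispatch / rejection rule
      (∀ j : Fin n, (∃ i ∈ S j, loadC i (c j) (j : ℕ) < α * Tstar) →
        ∃ i ∈ S j, assign j = some i ∧
          ∀ i' ∈ S j, loadC i (c j) (j : ℕ) ≤ loadC i' (c j) (j : ℕ)) →
      (∀ j : Fin n, assign j = none → ∀ i ∈ S j, α * Tstar ≤ loadC i (c j) (j : ℕ)) →
      -- Stage-2 pruning, independently within each group `c j mod Δ`: job `j` is
      -- still present at time `t` iff the total size of the smaller jobs of its own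
      -- group dispatched to the same machine so far is below `2α·T*`
      (∀ (j : Fin n) (t : ℕ), kept j t ↔
        ∃ i, assign j = some i ∧ (j : ℕ) < t ∧
          (∑ j' ∈ (univ : Finset (Fin n)).filter
              (fun j' : Fin n => (j' : ℕ) < t ∧ assign j' = some i ∧
                c j' % (Δ : ℤ) = c j % (Δ : ℤ) ∧
                (p j' < p j ∨ (p j' = p j ∧ j' < j))), p j') < 2 * α * Tstar) →
      -- the actual (total) load of a machine after pruning
      (∀ i t, load i t =
        ∑ j ∈ (univ : Finset (Fin n)).filter
            (fun j : Fin n => (j : ℕ) < t ∧ assign j = some i ∧ kept j t), p j) →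
      -- the offline optimum is at most `T*`
      (∃ opt : Fin n → Fin m, (∀ j, opt j ∈ S j) ∧
        ∀ i : Fin m,
          (∑ j ∈ (univ : Finset (Fin n)).filter (fun j => opt j = i), p j) ≤ Tstar) →
      -- conclusions: load at most `O(log²(1/ε))·T*`, at most an `ε`-fraction rejected
      (∀ i t, load i t ≤ C * Real.logb 2 (1 / ε) ^ 2 * Tstar) ∧
      (∀ t : ℕ,
        (((univ : Finset (Fin n)).filter
            (fun j : Fin n => (j : ℕ) < t ∧ (assign j = none ∨ ¬ kept j t))).card : ℝ)
          ≤ ε * t) := by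
  refine ⟨27, by norm_num, ?_⟩
  intro n m ε hε hε1 T α Δ hΔ0 p c S assign loadC kept load hα hΔ hp hc hSne hS hC hgreedy hnone
    hkept hload hoptex
  obtain ⟨opt, hopt, hoptT⟩ := hoptex
  set L := Real.logb 2 (1 / ε) with hL
  have hLpos : 0 < L := Real.logb_pos (by norm_num) (by rw [lt_div_iff₀ hε]; linarith)
  have hΔ3 : 3 ≤ Δ := by
    have : (2 : ℝ) < Δ := by linarith
    have : 2 < Δ := by exact_mod_cast this
    omega
  have hΔ3' : (3 : ℝ) ≤ Δ := by exact_mod_cast hΔ3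
  have hL1 : 1 ≤ L := by linarith
  have hα4 : 4 ≤ α := by linarith
  have hεΔ : ε * 2 ^ (Δ : ℤ) = 4 := by
    have h1 : (2 : ℝ) ^ (Δ : ℝ) = 1 / ε * 4 := by
      rw [hΔ, Real.rpow_add (by norm_num), hL, Real.rpow_logb (by norm_num) (by norm_num)
        (by positivity)]
      norm_num
    rw [Real.rpow_natCast] at h1
    rw [zpow_natCast, h1]; field_simp
  have hTi : Fin m → 0 ≤ T := fun i => (sum_nonneg (fun j _ => (hp j).le)).trans (hoptT i)
  have hpT : ∀ j, p j ≤ T := fun j =>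
    (single_le_sum (f := p) (s := univ.filter (fun j' => opt j' = opt j)) (fun j _ => (hp j).le)
      (mem_filter.2 ⟨mem_univ j, rfl⟩)).trans (hoptT (opt j))
  constructor
  · intro i t
    have hT := hTi i
    rw [hload]
    set Q := (univ : Finset (Fin n)).filter
            (fun j : Fin n => (j : ℕ) < t ∧ assign j = some i ∧ kept j t) with hQ
    have hm : ∀ j ∈ Q, c j % (Δ : ℤ) ∈ Finset.Ico (0 : ℤ) Δ := by
      intro j _
      have : (0 : ℤ) < Δ := by exact_mod_cast hΔ0
      exact mem_Ico.2 ⟨Int.emod_nonneg _ this.ne', Int.emod_lt_of_pos _ this⟩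
    have hfib : ∀ g, ∑ j ∈ Q.filter (fun j => c j % (Δ : ℤ) = g), p j ≤ 2 * α * T + T := by
      intro g
      set B := Q.filter (fun j => c j % (Δ : ℤ) = g) with hB
      rcases B.eq_empty_or_nonempty with he | hne
      · rw [he, sum_empty]
        have : 0 ≤ α := by linarith
        positivity
      obtain ⟨j0, hj0, hmax⟩ := B.exists_max_image (fun j => toLex (p j, j)) hne
      have h0 := hj0
      simp only [hB, hQ, mem_filter] at h0
      obtain ⟨i', hi', _, hlt⟩ := (hkept j0 t).1 h0.1.2.2.2
      have : i' = i := Option.some.inj (hi'.symm.trans h0.1.2.2.1)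
      subst this
      rw [← sum_erase_add _ _ hj0]
      refine add_le_add (le_trans ?_ hlt.le) (hpT j0)
      apply sum_le_sum_of_subset_of_nonneg
      · intro x hx
        rw [mem_erase] at hx
        have h1 := lt_of_le_of_ne (hmax x hx.2) (by
          intro he
          have := congrArg (fun z => (ofLex z).2) he
          exact hx.1 this)
        rw [Prod.Lex.toLex_lt_toLex] at h1
        have h2 := hx.2
        simp only [hB, hQ, mem_filter] at h2
        exact mem_filter.2 ⟨mem_univ _, h2.1.2.1, h2.1.2.2.1, h2.2.trans h0.2.symm, h1⟩
      · intro j _ _; exact (hp j).le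
    rw [← sum_fiberwise_of_maps_to hm]
    refine (sum_le_card_nsmul _ _ _ fun g _ => hfib g).trans ?_
    rw [nsmul_eq_mul, Int.card_Ico]
    simp only [sub_zero, Int.toNat_natCast]
    rw [hΔ, hα]
    have : (L + 2) * (2 * (2 * L + 2) + 1) ≤ 27 * L ^ 2 := by nlinarith
    have := mul_le_mul_of_nonneg_right this hT
    linarith
  · intro t
    obtain ⟨Rj, hRj⟩ : ∃ Rj : Fin n → Prop, ∀ j, Rj j ↔ ∀ i ∈ S j, α * T ≤ loadC i (c j) j :=
      ⟨_, fun _ => Iff.rfl⟩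
    obtain ⟨low, hlow⟩ : ∃ low : Fin n → Prop, ∀ j, low j ↔ (2 : ℝ) ^ (c j + Δ) ≤ T :=
      ⟨_, fun _ => Iff.rfl⟩
    set U := (univ : Finset (Fin n)).filter (fun j : Fin n => (j : ℕ) < t) with hU
    -- stage 2
    have stage2 : ∑ j ∈ U, (if assign j = none ∨ ¬ kept j t then (1 : ℝ) else 0)
        ≤ ∑ j ∈ U, ((if Rj j then (1 : ℝ) else 0) + ε / 2 * (if low j then (1 : ℝ) else 0)) := by
      apply lbFiberLe U (fun j => (assign j, c j % (Δ : ℤ)))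
      rintro ⟨a, g⟩
      cases a with
      | none =>
        refine sum_le_sum fun j hj => ?_
        have h1 : assign j = none := by
          have := (mem_filter.1 hj).2
          exact congrArg Prod.fst this
        have h2 : Rj j := (hRj j).2 (hnone j h1)
        rw [if_pos (Or.inl h1), if_pos h2]
        split_ifs <;> linarith
      | some i =>
        set J := U.filter (fun j => (assign j, c j % (Δ : ℤ)) = (some i, g)) with hJ
        have memJ : ∀ j, j ∈ J ↔ (j : ℕ) < t ∧ assign j = some i ∧ c j % (Δ : ℤ) = g := by
          intro j
          simp only [hJ, hU, mem_filter, mem_univ, true_and, Prod.mk.injEq]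
        rw [sum_add_distrib, ← mul_sum, sum_boole, sum_boole, sum_boole]
        have := lbPrune J p c Rj low T α ε Δ hα4 hε hΔ3 hεΔ hc hpT (fun j => (hlow j).2) (by
          intro j hj j' hj' hlt
          have e : c j % (Δ : ℤ) = c j' % (Δ : ℤ) := by
            rw [((memJ j).1 hj).2.2, ((memJ j').1 hj').2.2]
          have hd : (Δ : ℤ) ∣ c j - c j' := Int.ModEq.dvd e.symm
          have := Int.le_of_dvd (by omega) hd
          omega) (by
          intro k
          have hT := hTi i
          have hα0 : 0 ≤ α := by linarith
          have h0 : 0 ≤ α * T := mul_nonneg hα0 hT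
          have := lbStartUpper ((univ : Finset (Fin n)).filter
            (fun j : Fin n => (j : ℕ) < t ∧ assign j = some i ∧ c j = k)) p (α * T) T
            (fun j _ => (hp j).le) (fun j _ => hpT j) (by linarith)
            (J.filter (fun j => ¬ Rj j ∧ c j = k)) (by
              intro j hj
              rw [mem_filter, memJ] at hj
              exact mem_filter.2 ⟨mem_univ _, hj.1.1, hj.1.2.1, hj.2.2⟩) (by
              intro j hj
              rw [mem_filter, memJ] at hj
              obtain ⟨⟨hjt, hja, _⟩, hjR, hjk⟩ := hj
              rw [hRj] at hjR
              push Not at hjR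
              obtain ⟨i1, hi1, hl1⟩ := hjR
              obtain ⟨i2, _, h2a, h2⟩ := hgreedy j ⟨i1, hi1, hl1⟩
              have : i2 = i := Option.some.inj (h2a.symm.trans hja)
              subst this
              refine le_trans ?_ ((h2 i1 hi1).trans hl1.le)
              rw [hC, filter_filter]
              apply le_of_eq
              apply sum_congr _ fun _ _ => rfl
              ext x
              simp only [mem_filter, Fin.lt_def, hjk]
              constructor
              · rintro ⟨a, ⟨b, d⟩, e⟩; exact ⟨a, e, d⟩
              · rintro ⟨a, e, d⟩; exact ⟨a, ⟨e.trans hjt, d⟩, e⟩)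
          linarith)
        refine le_trans ?_ this
        have hsub : J.filter (fun j => assign j = none ∨ ¬ kept j t) ⊆
            J.filter (fun j => 2 * α * T ≤ ∑ j' ∈ J.filter
              (fun j' => p j' < p j ∨ (p j' = p j ∧ j' < j)), p j') := by
          intro j hj
          rw [mem_filter] at hj
          refine mem_filter.2 ⟨hj.1, ?_⟩
          have hm := (memJ j).1 hj.1
          rcases hj.2 with h | h
          · rw [hm.2.1] at h; cases h
          · by_contra hcon
            apply h
            rw [hkept]
            refine ⟨i, hm.2.1, hm.1, ?_⟩
            rw [not_le] at hcon
            refine lt_of_eq_of_lt ?_ hcon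
            apply sum_congr _ fun _ _ => rfl
            ext x
            rw [mem_filter, mem_filter, memJ, hm.2.2]
            simp only [mem_univ, true_and, and_assoc]
        exact_mod_cast card_le_card hsub
    -- stage 1
    have stage1 : ∑ j ∈ U, (if Rj j then (1 : ℝ) else 0)
        ≤ ∑ j ∈ U, (if low j then ε / 2 else ε) := by
      apply lbFiberLe U c
      intro k
      rw [sum_boole]
      rcases (U.filter (fun j => c j = k)).eq_empty_or_nonempty with he | ⟨j1, hj1⟩
      · rw [he]; simp
      have hT := hTi (opt j1)
      have hk1 : c j1 = k := (mem_filter.1 hj1).2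
      have eR : (U.filter (fun j => c j = k)).filter Rj = (univ : Finset (Fin n)).filter
          (fun j : Fin n => (j : ℕ) < t ∧ c j = k ∧ ∀ i ∈ S j, α * T ≤ loadC i k j) := by
        ext x
        simp only [hU, hRj, mem_filter, mem_univ, true_and, and_assoc]
        constructor
        · rintro ⟨a, b, d⟩; exact ⟨a, b, by rw [b] at d; exact d⟩
        · rintro ⟨a, b, d⟩; exact ⟨a, b, by rw [b]; exact d⟩
      have eU : U.filter (fun j => c j = k) = (univ : Finset (Fin n)).filter
          (fun j : Fin n => (j : ℕ) < t ∧ c j = k) := by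
        rw [hU, filter_filter]
      have hεD : ε * 2 ^ Δ = 4 := by simpa using hεΔ
      by_cases hl : (2 : ℝ) ^ (k + Δ) ≤ T
      · have hs : (2 : ℝ) ^ (k + 1) ≤ T / 4 := by
          have h1 : (2 : ℝ) ^ (k + 1) * 4 = 2 ^ (k + 3) := by
            rw [zpow_add₀ (by norm_num), zpow_add₀ (by norm_num)]; norm_num; ring
          have h2 : (2 : ℝ) ^ (k + 3) ≤ 2 ^ (k + (Δ : ℤ)) :=
            zpow_le_zpow_right₀ (by norm_num) (by omega)
          linarith
        have := lbStage1 p c S assign loadC (α * T) T (T / 4) k t hp hc hC hS hgreedy opt hopt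
          hoptT (fun j hj => by
            have := (hc j).2
            rw [hj] at this; linarith) (by linarith) hT Δ (by
            have : (Δ : ℝ) * (5 / 4) ≤ α := by linarith
            have := mul_le_mul_of_nonneg_right this hT
            linarith)
        rw [← eR, ← eU] at this
        have e2 : ∑ j ∈ U.filter (fun j => c j = k), (if low j then ε / 2 else ε)
            = (U.filter (fun j => c j = k)).card * (ε / 2) := by
          rw [← nsmul_eq_mul, ← sum_const]
          refine sum_congr rfl fun j hj => if_pos ?_
          simp only [hlow]; rw [(mem_filter.1 hj).2]; exact hl
        rw [e2]
        have := mul_le_mul_of_nonneg_left this hε.le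
        rw [← mul_assoc, hεD] at this
        linarith
      · obtain ⟨D, rfl⟩ : ∃ D, Δ = D + 1 := ⟨Δ - 1, by omega⟩
        have := lbStage1 p c S assign loadC (α * T) T T k t hp hc hC hS hgreedy opt hopt
          hoptT (fun j hj => hpT j) hT hT D (by
            have : (D : ℝ) * 2 ≤ α := by push_cast at hΔ; linarith
            have := mul_le_mul_of_nonneg_right this hT
            linarith)
        rw [← eR, ← eU] at this
        have e2 : ∑ j ∈ U.filter (fun j => c j = k), (if low j then ε / 2 else ε)
            = (U.filter (fun j => c j = k)).card * ε := by
          rw [← nsmul_eq_mul, ← sum_const]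
          refine sum_congr rfl fun j hj => if_neg ?_
          simp only [hlow]; rw [(mem_filter.1 hj).2]; exact hl
        rw [e2]
        have := mul_le_mul_of_nonneg_left this hε.le
        rw [pow_succ] at hεD
        have hεD' : ε * 2 ^ D = 2 := by linarith
        rw [← mul_assoc, hεD'] at this
        linarith
    have hcard : (U.card : ℝ) ≤ t := by
      have : U.card ≤ (range t).card := by
        refine card_le_card_of_injOn (fun j => (j : ℕ)) ?_ ?_
        · intro j hj
          simpa [hU] using hj
        · intro a _ b _ h; exact Fin.ext h
      rw [card_range] at this
      exact_mod_cast this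
    have hfin : ∑ j ∈ U, (if low j then ε / 2 else ε)
        + ∑ j ∈ U, ε / 2 * (if low j then (1 : ℝ) else 0) = ε * U.card := by
      rw [← sum_add_distrib, mul_comm, ← nsmul_eq_mul, ← sum_const]
      refine sum_congr rfl fun j _ => ?_
      split_ifs <;> ring
    rw [sum_add_distrib] at stage2
    rw [sum_boole, hU, filter_filter, ← hU] at stage2
    have := mul_le_mul_of_nonneg_left hcard hε.le
    linarith
end

section
/- Fix the greedy unit-size MaxFlowTime algorithm (each arriving job is dispatched to the machine in S_j with smallest queue; it is rejected if all queues of machines in S_j have at least α·T* jobs; machines process jobs in dispatch order), a machine i, a time t*, and a parameter l with 1 ≤ l ≤ α, and let Int(i,l) be the set of maximal machine intervals constructed backwards from t* whose right endpoint t₂ has load_i(t₂) ≥ l·T* and on whose interior the load stays strictly above (l−1)·T*. Then: (covering) for every job j with level(j) ≥ l·T* and every i ∈ S_j there is an interval (I,i) ∈ Int(i,l) with r_j ∈ I; (nesting) every interval of Int(i,l) is contained in some interval of Int(i,l−1); and (processing) for every interval (I,i) ∈ Int(i,l), the number of jobs dispatched to i during I is at least length(I) + T*. -/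
open Finset

/-!
Properties of the backwards-constructed interval families for the greedy unit-size
`MaxFlowTime` algorithm.  Time is discrete; `load i t` is the queue length of
machine `i` at the beginning of time `t` (one job is processed per time step when
the queue is nonempty, jobs released at `t` being available at step `t`).  The
greedy algorithm dispatches each arriving job `j` to a machine of `S j` of smallest
queue, rejecting it iff all queues of machines in `S j` have at least `α·T*` jobs;
`level j` is the queue length seen by `j` on the machine it is dispatched to.
For a machine `i` and a parameter `l ≥ 1`, `Int i l` is the family of maximal
disjoint intervals `(a, b]` with `b ≤ t*`, constructed backwards from `t*`, whose
right endpoint satisfies `load i b ≥ l·T*`, on whose interior the load stays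
strictly above `(l−1)·T*`, and whose left endpoint is earliest possible; the
backward-greedy construction is characterized by: every `t ≤ t*` with
`load i t ≥ l·T*` is covered by some interval of `Int i l`.
Conclusions (for fixed `i`, `t*` and `1 ≤ l ≤ α`): covering, nesting (for `l ≥ 2`),
and the processing bound `#{jobs dispatched to i during I} ≥ length I + T*`.
-/
theorem maxflowtime_unit_interval_properties
    (n m : ℕ) (Tstar α : ℕ) (hT : 0 < Tstar) (hα : 0 < α)
    (tstar : ℕ)
    (r : Fin n → ℕ) (S : Fin n → Finset (Fin m))
    (hS : ∀ j, (S j).Nonempty)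
    (assign : Fin n → Option (Fin m))
    (hassign : ∀ j i, assign j = some i → i ∈ S j)
    (arr : Fin m → ℕ → ℕ)
    (harr : ∀ i t, arr i t =
      ((univ : Finset (Fin n)).filter (fun j : Fin n => r j = t ∧ assign j = some i)).card)
    (load : Fin m → ℕ → ℕ)
    (hload0 : ∀ i, load i 0 = 0)
    -- queue dynamics: one job processed per step when the queue is nonempty
    (hloadstep : ∀ i t, load i (t + 1) =
      load i t + arr i t - (if 0 < load i t + arr i t then 1 else 0))
    -- greedy dispatch / rejection rule
    (hgreedy : ∀ j : Fin n, (∃ i ∈ S j, load i (r j) < α * Tstar) →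
      ∃ i ∈ S j, assign j = some i ∧ ∀ i' ∈ S j, load i (r j) ≤ load i' (r j))
    (hreject : ∀ j : Fin n, assign j = none → ∀ i ∈ S j, α * Tstar ≤ load i (r j))
    (level : Fin n → ℕ)
    (hlevel : ∀ (j : Fin n) (i : Fin m), assign j = some i → level j = load i (r j))
    -- the interval families `Int i l` (intervals `(a, b]` encoded as pairs `(a, b)`)
    (Int : Fin m → ℕ → Finset (ℕ × ℕ))
    (hInt : ∀ (i : Fin m) (l : ℕ), 1 ≤ l → ∀ q ∈ Int i l,
      q.1 < q.2 ∧ q.2 ≤ tstar ∧ l * Tstar ≤ load i q.2 ∧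
      (∀ t, q.1 < t → t ≤ q.2 → (l - 1) * Tstar < load i t) ∧
      (q.1 = 0 ∨ load i q.1 ≤ (l - 1) * Tstar))
    (hdisj : ∀ (i : Fin m) (l : ℕ), 1 ≤ l → ∀ q ∈ Int i l, ∀ q' ∈ Int i l,
      q ≠ q' → q.2 ≤ q'.1 ∨ q'.2 ≤ q.1)
    (hmax : ∀ (i : Fin m) (l : ℕ), 1 ≤ l → ∀ t ≤ tstar,
      l * Tstar ≤ load i t → ∃ q ∈ Int i l, q.1 < t ∧ t ≤ q.2)
    -- the fixed machine and parameter of the lemma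
    (i : Fin m) (l : ℕ) (hl : 1 ≤ l) (hlα : l ≤ α) :
    -- (covering)
    (∀ j : Fin n, r j ≤ tstar → l * Tstar ≤ level j → (assign j).isSome →
      ∀ i' ∈ S j, ∃ q ∈ Int i' l, q.1 < r j ∧ r j ≤ q.2) ∧
    -- (nesting)
    (2 ≤ l → ∀ q ∈ Int i l, ∃ q' ∈ Int i (l - 1), q'.1 ≤ q.1 ∧ q.2 ≤ q'.2) ∧
    -- (processing): at least `length I + T*` jobs are dispatched to `i` during `I`
    (∀ q ∈ Int i l,
      (q.2 - q.1) + Tstar ≤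
        ((univ : Finset (Fin n)).filter
          (fun j : Fin n => assign j = some i ∧ q.1 ≤ r j ∧ r j < q.2)).card) := by
  refine ⟨?_, ?_, ?_⟩
  · intro j hj hlev hsome i' hi'
    apply hmax i' l hl (r j) hj
    by_cases h : ∃ i ∈ S j, load i (r j) < α * Tstar
    · obtain ⟨k, hk, hak, hmin⟩ := hgreedy j h
      have h1 := hlevel j k hak
      have h2 := hmin i' hi'
      omega
    · push Not at h
      exact le_trans (Nat.mul_le_mul_right _ hlα) (h i' hi')
  · intro h2 q hq
    obtain ⟨hq1, hq2, hq3, hq4, hq5⟩ := hInt i l hl q hq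
    have hle : (l - 1) * Tstar ≤ load i q.2 :=
      le_trans (Nat.mul_le_mul_right _ (Nat.sub_le l 1)) hq3
    obtain ⟨q', hq', ha, hb⟩ := hmax i (l - 1) (by omega) q.2 hq2 hle
    refine ⟨q', hq', ?_, hb⟩
    by_contra hc
    push Not at hc
    obtain ⟨_, _, _, _, h5⟩ := hInt i (l - 1) (by omega) q' hq'
    rcases h5 with h5 | h5
    · omega
    · have h6 := hq4 q'.1 hc ha.le
      have h7 : (l - 1 - 1) * Tstar ≤ (l - 1) * Tstar :=
        Nat.mul_le_mul_right _ (Nat.sub_le _ 1)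
      omega
  · intro q hq
    obtain ⟨hq1, hq2, hq3, hq4, hq5⟩ := hInt i l hl q hq
    have key : ∀ d, q.1 + d ≤ q.2 →
        load i (q.1 + d) + d = load i q.1 +
          ((univ : Finset (Fin n)).filter
            (fun j : Fin n => assign j = some i ∧ q.1 ≤ r j ∧ r j < q.1 + d)).card := by
      intro d
      induction d with
      | zero =>
        intro _
        have : ((univ : Finset (Fin n)).filter
            (fun j : Fin n => assign j = some i ∧ q.1 ≤ r j ∧ r j < q.1 + 0)) = ∅ := by
          apply Finset.filter_false_of_mem
          intro j _ h
          omega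
        rw [this]
        simp
      | succ d ih =>
        intro hd
        have ih' := ih (by omega)
        have hst := hloadstep i (q.1 + d)
        have hpos := hq4 (q.1 + (d + 1)) (by omega) hd
        have hsplit : ((univ : Finset (Fin n)).filter
            (fun j : Fin n => assign j = some i ∧ q.1 ≤ r j ∧ r j < q.1 + (d + 1))).card =
            ((univ : Finset (Fin n)).filter
            (fun j : Fin n => assign j = some i ∧ q.1 ≤ r j ∧ r j < q.1 + d)).card
            + arr i (q.1 + d) := by
          rw [harr, ← Finset.card_union_of_disjoint]
          · congr 1
            ext j
            simp only [Finset.mem_filter, Finset.mem_union, Finset.mem_univ, true_and]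
            constructor
            · rintro ⟨h1, h2, h3⟩
              by_cases h : r j = q.1 + d
              · exact Or.inr ⟨h, h1⟩
              · exact Or.inl ⟨h1, h2, by omega⟩
            · rintro (⟨h1, h2, h3⟩ | ⟨h1, h2⟩)
              · exact ⟨h1, h2, by omega⟩
              · exact ⟨h2, by omega, by omega⟩
          · rw [Finset.disjoint_left]
            intro j h1 h2
            simp only [Finset.mem_filter, Finset.mem_univ, true_and] at h1 h2
            omega
        rw [hsplit]
        rw [add_assoc q.1 d 1] at hst
        split_ifs at hst with hc <;> omega
    have hk := key (q.2 - q.1) (by omega)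
    rw [Nat.add_sub_cancel' hq1.le] at hk
    have ha : load i q.1 ≤ (l - 1) * Tstar := by
      rcases hq5 with h | h
      · rw [h, hload0]
        exact Nat.zero_le _
      · exact h
    have hl' : l * Tstar = (l - 1) * Tstar + Tstar := by
      obtain ⟨k, rfl⟩ : ∃ k, l = k + 1 := ⟨l - 1, by omega⟩
      simp [Nat.add_mul]
    omega
end
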